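/- arXiv:1908.08286 — 7 statements merged into one kernel-verified Lean document; each statement's English description precedes it below -/
import Mathlib

section
/- Let σ : ℝ → ℝ be a sigmoid function, i.e. a non-constant, bounded, monotone non-decreasing continuous function. Let K be a compact subset of ℝⁿ and f : K → ℝᵐ a continuous map. Then for every ε > 0 there exist an integer N > 0, an m × N real matrix A, an N × n real matrix B, and a vector θ ∈ ℝᴺ such that for all x ∈ K, ‖f(x) − A·σ_N(Bx + θ)‖ < ε, where σ_N : ℝᴺ → ℝᴺ applies σ to each coordinate. -/
open Filter Topology Set

/-- A continuous function on `[-R, R]` is uniformly approximated by a constant plus a finite linear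
combination of dilated translates of a continuous step-like function `s`. -/
theorem exists_step_combination_approx {s : ℝ → ℝ} (hs₀ : ∀ x, 0 ≤ s x) (hs₁ : ∀ x, s x ≤ 1)
    (hbot : Tendsto s atBot (𝓝 0)) (htop : Tendsto s atTop (𝓝 1))
    {g : ℝ → ℝ} {R : ℝ} (hR : 0 < R) (hg : ContinuousOn g (Icc (-R) R))
    {ε : ℝ} (hε : 0 < ε) :
    ∃ (p : ℕ) (w c : ℕ → ℝ) (l d : ℝ), ∀ t ∈ Icc (-R) R,
      |d + ∑ i ∈ Finset.range p, w i * s (l * t + c i) - g t| ≤ ε := by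
  have huc := isCompact_Icc.uniformContinuousOn_of_continuous hg
  rw [Metric.uniformContinuousOn_iff] at huc
  obtain ⟨δ, hδ, hδg⟩ := huc (ε / 3) (by positivity)
  obtain ⟨p, hp⟩ := exists_nat_gt (2 * R / δ)
  have hp₀ : (0 : ℝ) < p := lt_trans (by positivity) hp
  set h : ℝ := 2 * R / p with h_def
  have hh : 0 < h := by positivity
  have hph : p * h = 2 * R := by rw [h_def]; field_simp
  have hhδ : h < δ := by
    rw [h_def, div_lt_iff₀ hp₀]
    rwa [div_lt_iff₀ hδ, mul_comm (p : ℝ)] at hp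
  obtain ⟨T, hT⟩ : ∃ T : ℝ, 0 < T ∧ (∀ x ≤ -T, s x ≤ 1 / p) ∧ ∀ x ≥ T, 1 - 1 / p ≤ s x := by
    have h₁ : ∀ᶠ x in atBot, s x ≤ 1 / p := (hbot.eventually_lt_const (by positivity)).mono
      fun _ => le_of_lt
    have h₂ : ∀ᶠ x in atTop, 1 - 1 / p ≤ s x := (htop.eventually_const_lt
      (sub_lt_self _ (by positivity : (0 : ℝ) < 1 / p))).mono fun _ => le_of_lt
    obtain ⟨a, ha⟩ := eventually_atBot.1 h₁
    obtain ⟨b, hb⟩ := eventually_atTop.1 h₂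
    refine ⟨max 1 (max (-a) b), by positivity, fun x hx => ha x ?_, fun x hx => hb x ?_⟩
    · linarith [le_max_right 1 (max (-a) b), le_max_left (-a) b]
    · linarith [le_max_right 1 (max (-a) b), le_max_right (-a) b]
  obtain ⟨hT₀, hTbot, hTtop⟩ := hT
  set τ : ℕ → ℝ := fun i => -R + i * h with τ_def
  have hτ_succ (i : ℕ) : τ (i + 1) = τ i + h := by simp only [τ_def]; push_cast; ring
  have hτ_mem {i : ℕ} (hi : i ≤ p) : τ i ∈ Icc (-R) R := by
    have : (i : ℝ) * h ≤ p * h := by gcongr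
    have : 0 ≤ (i : ℝ) * h := by positivity
    constructor <;> simp only [τ_def] <;> linarith
  have hosc {x y : ℝ} (hx : x ∈ Icc (-R) R) (hy : y ∈ Icc (-R) R) (hxy : |x - y| ≤ h) :
      |g x - g y| ≤ ε / 3 := by
    have := hδg x hx y hy (by rw [Real.dist_eq]; linarith)
    rw [Real.dist_eq] at this
    exact this.le
  set l : ℝ := 2 * T / h with l_def
  have hl : 0 < l := by positivity
  have hlh : l * (h / 2) = T := by rw [l_def]; field_simp
  refine ⟨p, fun i => g (τ (i + 1)) - g (τ i), fun i => -(l * (τ i + h / 2)), l, g (-R),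
    fun t ht => ?_⟩
  have htel : g t = g (-R) +
      ∑ i ∈ Finset.range p, (g (min t (τ (i + 1))) - g (min t (τ i))) := by
    rw [Finset.sum_range_sub (fun i => g (min t (τ i)))]
    have hτp : τ p = R := by simp only [τ_def]; linarith
    have hτ0 : τ 0 = -R := by simp [τ_def]
    rw [hτp, hτ0, min_eq_left ht.2, min_eq_right ht.1]
    ring
  have hterm (i : ℕ) (hi : i ∈ Finset.range p) :
      |(g (τ (i + 1)) - g (τ i)) * s (l * t + -(l * (τ i + h / 2)))
        - (g (min t (τ (i + 1))) - g (min t (τ i)))|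
      ≤ ε / 3 * (1 / p) + if τ i < t ∧ t < τ (i + 1) then 2 * (ε / 3) else 0 := by
    have hip : i < p := Finset.mem_range.1 hi
    have hw : |g (τ (i + 1)) - g (τ i)| ≤ ε / 3 :=
      hosc (hτ_mem hip) (hτ_mem hip.le) (by rw [hτ_succ, add_sub_cancel_left, abs_of_pos hh])
    rw [show l * t + -(l * (τ i + h / 2)) = l * (t - τ i - h / 2) by ring]
    set u := s (l * (t - τ i - h / 2)) with u_def
    have hu₀ : 0 ≤ u := hs₀ _
    have hu₁ : u ≤ 1 := hs₁ _
    rcases le_or_gt t (τ i) with hti | hti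
    · rw [min_eq_left hti, min_eq_left (by rw [hτ_succ]; linarith), if_neg (by grind),
        sub_self, sub_zero, add_zero, abs_mul, abs_of_nonneg hu₀]
      gcongr
      refine hTbot _ ?_
      nlinarith
    rcases le_or_gt (τ (i + 1)) t with hti' | hti'
    · rw [min_eq_right hti', min_eq_right hti.le, if_neg (by grind), add_zero, ← mul_sub_one,
        abs_mul, abs_sub_comm, abs_sub_comm u, abs_of_nonneg (sub_nonneg.2 hu₁), abs_sub_comm]
      gcongr
      have : 1 - 1 / (p : ℝ) ≤ u := by
        refine hTtop _ ?_
        rw [hτ_succ] at hti'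
        nlinarith
      linarith
    · rw [min_eq_left hti'.le, min_eq_right hti.le, if_pos ⟨hti, hti'⟩]
      have h₁ : |(g (τ (i + 1)) - g (τ i)) * u| ≤ ε / 3 := by
        rw [abs_mul, abs_of_nonneg hu₀]
        nlinarith [abs_nonneg (g (τ (i + 1)) - g (τ i))]
      have h₂ : |g t - g (τ i)| ≤ ε / 3 := by
        refine hosc ht (hτ_mem hip.le) ?_
        rw [hτ_succ] at hti'
        rw [abs_of_pos (by linarith)]
        linarith
      have h₃ : 0 ≤ ε / 3 * (1 / p) := by positivity
      linarith [abs_sub ((g (τ (i + 1)) - g (τ i)) * u) (g t - g (τ i))]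
  have hone : ((Finset.range p).filter fun i => τ i < t ∧ t < τ (i + 1)).card ≤ 1 := by
    refine Finset.card_le_one.2 fun i hi j hj => ?_
    simp only [Finset.mem_filter, τ_def] at hi hj
    have h₁ : (i : ℝ) * h < ((j + 1 : ℕ) : ℝ) * h := by linarith [hi.2.1, hj.2.2]
    have h₂ : (j : ℝ) * h < ((i + 1 : ℕ) : ℝ) * h := by linarith [hj.2.1, hi.2.2]
    have h₃ := lt_of_mul_lt_mul_right h₁ hh.le
    have h₄ := lt_of_mul_lt_mul_right h₂ hh.le
    norm_cast at h₃ h₄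
    omega
  rw [htel, add_sub_add_left_eq_sub, ← Finset.sum_sub_distrib]
  refine (Finset.abs_sum_le_sum_abs _ _).trans ((Finset.sum_le_sum hterm).trans ?_)
  rw [Finset.sum_add_distrib, ← Finset.sum_filter, Finset.sum_const, Finset.sum_const,
    Finset.card_range, nsmul_eq_mul, nsmul_eq_mul]
  have h₁ : (p : ℝ) * (ε / 3 * (1 / p)) = ε / 3 := by field_simp
  have h₂ : ((((Finset.range p).filter fun i => τ i < t ∧ t < τ (i + 1)).card : ℕ) : ℝ) ≤ 1 := by
    exact_mod_cast hone
  nlinarith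

section Ridge

variable {n : ℕ} {K : Set (Fin n → ℝ)}

/-- The ridge function `x ↦ g (a ⬝ᵥ x + θ)` on `K`. -/
def ridge (K : Set (Fin n → ℝ)) (g : C(ℝ, ℝ)) (a : Fin n → ℝ) (θ : ℝ) : C(K, ℝ) where
  toFun x := g (a ⬝ᵥ x.1 + θ)
  continuous_toFun := by fun_prop

@[simp]
theorem ridge_apply (g : C(ℝ, ℝ)) (a : Fin n → ℝ) (θ : ℝ) (x : K) :
    ridge K g a θ x = g (a ⬝ᵥ x.1 + θ) := rfl

/-- The span of the ridge functions of `σ`. -/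
def ridgeSpan (K : Set (Fin n → ℝ)) (σ : C(ℝ, ℝ)) : Submodule ℝ C(K, ℝ) :=
  Submodule.span ℝ (range fun q : (Fin n → ℝ) × ℝ => ridge K σ q.1 q.2)

theorem ridge_mem_ridgeSpan (σ : C(ℝ, ℝ)) (a : Fin n → ℝ) (θ : ℝ) :
    ridge K σ a θ ∈ ridgeSpan K σ :=
  Submodule.subset_span ⟨(a, θ), rfl⟩

theorem const_mem_ridgeSpan {σ : C(ℝ, ℝ)} {θ : ℝ} (hθ : σ θ ≠ 0) (c : ℝ) :
    ContinuousMap.const K c ∈ ridgeSpan K σ := by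
  have : ContinuousMap.const K c = (c / σ θ) • ridge K σ 0 θ := by
    ext x
    simp [hθ]
  rw [this]
  exact Submodule.smul_mem _ _ (ridge_mem_ridgeSpan σ 0 θ)

theorem ridge_mem_topologicalClosure_ridgeSpan [CompactSpace K] {σ : C(ℝ, ℝ)}
    (hmono : Monotone σ) (hnonconst : ∃ x y : ℝ, σ x ≠ σ y) (hbdd : ∃ M : ℝ, ∀ x, |σ x| ≤ M)
    (g : C(ℝ, ℝ)) (a : Fin n → ℝ) :
    ridge K g a 0 ∈ (ridgeSpan K σ).topologicalClosure := by
  obtain ⟨θ₀, hθ₀⟩ : ∃ θ, σ θ ≠ 0 := by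
    obtain ⟨x, y, hxy⟩ := hnonconst
    by_contra! hzero
    exact hxy (by rw [hzero, hzero])
  obtain ⟨M, hM⟩ := hbdd
  have hA : BddAbove (range σ) := ⟨M, by rintro _ ⟨x, rfl⟩; exact (abs_le.1 (hM x)).2⟩
  have hB : BddBelow (range σ) := ⟨-M, by rintro _ ⟨x, rfl⟩; exact (abs_le.1 (hM x)).1⟩
  have htop := tendsto_atTop_ciSup hmono hA
  have hbot := tendsto_atBot_ciInf hmono hB
  set U := ⨆ x, σ x
  set L := ⨅ x, σ x
  have hU (x : ℝ) : σ x ≤ U := le_ciSup hA x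
  have hL (x : ℝ) : L ≤ σ x := ciInf_le hB x
  have hLU : 0 < U - L := by
    obtain ⟨x, y, hxy⟩ := hnonconst
    by_contra! hle
    exact hxy (by linarith [hU x, hU y, hL x, hL y])
  obtain ⟨R, hR, hRK⟩ : ∃ R : ℝ, 0 < R ∧ ∀ x : K, a ⬝ᵥ x.1 ∈ Icc (-R) R := by
    refine ⟨‖ridge K (.id ℝ) a 0‖ + 1, by positivity, fun x => abs_le.1 ?_⟩
    have := (ridge K (.id ℝ) a 0).norm_coe_le_norm x
    simp only [ridge_apply, ContinuousMap.id_apply, add_zero, Real.norm_eq_abs] at this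
    linarith
  rw [← SetLike.mem_coe, Submodule.topologicalClosure_coe, Metric.mem_closure_iff]
  intro ε hε
  obtain ⟨p, w, c, l, d, happrox⟩ := exists_step_combination_approx
    (s := fun x => (σ x - L) / (U - L))
    (fun x => div_nonneg (sub_nonneg.2 (hL x)) hLU.le)
    (fun x => (div_le_one hLU).2 (sub_le_sub_right (hU x) L))
    (by simpa using (hbot.sub_const L).div_const (U - L))
    (by simpa [hLU.ne'] using (htop.sub_const L).div_const (U - L))
    hR g.continuous.continuousOn (half_pos hε)
  refine ⟨ContinuousMap.const K d + ∑ i ∈ Finset.range p,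
    (w i / (U - L)) • (ridge K σ (l • a) (c i) - ContinuousMap.const K L), ?_, ?_⟩
  · exact add_mem (const_mem_ridgeSpan hθ₀ d) (sum_mem fun i _ => Submodule.smul_mem _ _
      (sub_mem (ridge_mem_ridgeSpan _ _ _) (const_mem_ridgeSpan hθ₀ L)))
  · rw [dist_comm]
    refine lt_of_le_of_lt ((ContinuousMap.dist_le (half_pos hε).le).2 fun x => ?_) (half_lt_self hε)
    convert happrox _ (hRK x) using 1
    simp [Real.dist_eq, ContinuousMap.sum_apply, mul_div_assoc, div_mul_eq_mul_div]

/-- Ridge functions of a sigmoid span a dense subspace of `C(K, ℝ)`. -/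
theorem topologicalClosure_ridgeSpan_eq_top [CompactSpace K] {σ : C(ℝ, ℝ)}
    (hmono : Monotone σ) (hnonconst : ∃ x y : ℝ, σ x ≠ σ y) (hbdd : ∃ M : ℝ, ∀ x, |σ x| ≤ M) :
    (ridgeSpan K σ).topologicalClosure = ⊤ := by
  set e : C(ℝ, ℝ) := ⟨Real.exp, Real.continuous_exp⟩
  let S : Submonoid C(K, ℝ) :=
    { carrier := range fun a => ridge K e a 0
      one_mem' := ⟨0, by ext x; simp [e]⟩
      mul_mem' := by
        rintro _ _ ⟨a, rfl⟩ ⟨b, rfl⟩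
        exact ⟨a + b, by ext x; simp [e, add_dotProduct, Real.exp_add]⟩ }
  have hsep : (Algebra.adjoin ℝ (S : Set C(K, ℝ))).SeparatesPoints := by
    intro x y hxy
    obtain ⟨i, hi⟩ := Function.ne_iff.1 (Subtype.coe_injective.ne hxy)
    refine ⟨_, ⟨ridge K e (Pi.single i 1) 0, Algebra.subset_adjoin ⟨_, rfl⟩, rfl⟩, ?_⟩
    simpa [e] using hi
  have hdense := ContinuousMap.subalgebra_topologicalClosure_eq_top_of_separatesPoints _ hsep
  have hspan : (Algebra.adjoin ℝ (S : Set C(K, ℝ))).toSubmodule ≤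
      (ridgeSpan K σ).topologicalClosure := by
    rw [Algebra.adjoin_eq_span, Submonoid.closure_eq, Submodule.span_le]
    rintro _ ⟨a, rfl⟩
    exact ridge_mem_topologicalClosure_ridgeSpan hmono hnonconst hbdd e a
  rw [eq_top_iff]
  intro f _
  have hf : f ∈ (Algebra.adjoin ℝ (S : Set C(K, ℝ))).topologicalClosure := hdense ▸ trivial
  exact closure_minimal hspan (Submodule.isClosed_topologicalClosure _) hf

end Ridge

/-- **Universal approximation by one-hidden-layer sigmoid networks** (Funahashi).
If `σ : ℝ → ℝ` is a sigmoid function (non-constant, bounded, monotone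
non-decreasing, continuous), `K ⊆ ℝⁿ` is compact and `f : K → ℝᵐ` is continuous,
then for every `ε > 0` there exist `N > 0`, an `m × N` matrix `A`, an `N × n`
matrix `B` and `θ ∈ ℝᴺ` such that `‖f x − A ⬝ σ_N (B ⬝ x + θ)‖ < ε` on `K`. -/
theorem sigmoid_universal_approximation (n m : ℕ) (σ : ℝ → ℝ)
    (hσ_cont : Continuous σ) (hσ_mono : Monotone σ)
    (hσ_nonconst : ∃ x y : ℝ, σ x ≠ σ y)
    (hσ_bdd : ∃ M : ℝ, ∀ x : ℝ, |σ x| ≤ M)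
    (K : Set (Fin n → ℝ)) (hK : IsCompact K)
    (f : (Fin n → ℝ) → (Fin m → ℝ)) (hf : ContinuousOn f K)
    (ε : ℝ) (hε : 0 < ε) :
    ∃ N : ℕ, 0 < N ∧
      ∃ (A : Matrix (Fin m) (Fin N) ℝ) (B : Matrix (Fin N) (Fin n) ℝ)
        (θ : Fin N → ℝ),
        ∀ x ∈ K,
          ‖f x - A.mulVec (fun i => σ (B.mulVec x i + θ i))‖ < ε := by
  have : CompactSpace K := isCompact_iff_compactSpace.1 hK
  let σ' : C(ℝ, ℝ) := ⟨σ, hσ_cont⟩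
  have hdense : (ridgeSpan K σ').topologicalClosure = ⊤ :=
    topologicalClosure_ridgeSpan_eq_top hσ_mono hσ_nonconst hσ_bdd
  let F (j : Fin m) : C(K, ℝ) :=
    ⟨fun x => f x j, (continuous_apply j).comp hf.domRestrict⟩
  have happrox (j : Fin m) : ∃ c : ((Fin n → ℝ) × ℝ) →₀ ℝ,
      dist (F j) (c.sum fun q r => r • ridge K σ' q.1 q.2) < ε := by
    have hF : F j ∈ closure (ridgeSpan K σ' : Set C(K, ℝ)) := by
      rw [← Submodule.topologicalClosure_coe, hdense]
      trivial
    obtain ⟨v, hv, hdist⟩ := Metric.mem_closure_iff.1 hF ε hε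
    obtain ⟨c, rfl⟩ := Finsupp.mem_span_range_iff_exists_finsupp.1 hv
    exact ⟨c, hdist⟩
  choose c hc using happrox
  classical
  let s : Finset ((Fin n → ℝ) × ℝ) := insert 0 (Finset.univ.biUnion fun j => (c j).support)
  have hs (j : Fin m) : (c j).support ⊆ s :=
    (Finset.subset_biUnion_of_mem (fun j => (c j).support) (Finset.mem_univ j)).trans
      (Finset.subset_insert _ _)
  let e : Fin s.card ≃ s := s.equivFin.symm
  refine ⟨s.card, Finset.card_pos.2 ⟨0, Finset.mem_insert_self _ _⟩,
    .of fun j i => c j (e i), .of fun i => (e i).1.1, fun i => (e i).1.2, fun x hx => ?_⟩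
  refine (pi_norm_lt_iff hε).2 fun j => ?_
  have hsum : (c j).sum (fun q r => r • ridge K σ' q.1 q.2) ⟨x, hx⟩ =
      ∑ i, c j (e i) * σ ((e i).1.1 ⬝ᵥ x + (e i).1.2) := by
    rw [Finsupp.sum_of_support_subset _ (hs j) _ (by simp), ContinuousMap.sum_apply,
      ← Finset.sum_coe_sort s, ← e.sum_comp]
    rfl
  have hdist := (ContinuousMap.dist_apply_le_dist ⟨x, hx⟩).trans_lt (hc j)
  rw [hsum, Real.dist_eq] at hdist
  exact hdist
end

section
/- Let S < T be real numbers, let X : ℝ → ℝ be continuously differentiable on [S, T], and let k ≥ 1. Then the Lebesgue integral over the open simplex Δ_k(S,T) = {u ∈ ℝᵏ : S < u₁ < ⋯ < u_k < T} of the product ∏_{j=1}^k X′(u_j) equals (X(T) − X(S))ᵏ / k!. -/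
open MeasureTheory

/-- The tuples `u` for which `u ∘ σ` is strictly increasing form a measurable set. -/
theorem measurableSet_strictMono_comp {k : ℕ} (σ : Equiv.Perm (Fin k)) :
    MeasurableSet {u : Fin k → ℝ | StrictMono (u ∘ σ)} := by
  have h : {u : Fin k → ℝ | StrictMono (u ∘ σ)} =
      ⋂ (i : Fin k) (j : Fin k) (_ : i < j), {u | u (σ i) < u (σ j)} := by
    ext u
    simp [StrictMono]
  rw [h]
  exact MeasurableSet.iInter fun i => MeasurableSet.iInter fun j => MeasurableSet.iInter fun _ =>
    measurableSet_lt (measurable_pi_apply _) (measurable_pi_apply _)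

/-- Distinct permutations cannot sort the same tuple strictly. -/
theorem eq_of_strictMono_comp {k : ℕ} {u : Fin k → ℝ} {σ τ : Equiv.Perm (Fin k)}
    (hσ : StrictMono (u ∘ σ)) (hτ : StrictMono (u ∘ τ)) : σ = τ := by
  have hu : Function.Injective u := (Equiv.injective_comp σ u).1 hσ.injective
  have h : u ∘ σ = u ∘ τ := by
    rw [← hσ.range_inj hτ, σ.surjective.range_comp, τ.surjective.range_comp]
  exact Equiv.ext fun i => hu (congrFun h i)

/-- Almost every tuple of reals has pairwise distinct entries. -/
theorem ae_injective (k : ℕ) : ∀ᵐ u : Fin k → ℝ, Function.Injective u := by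
  have h : ∀ i j : Fin k, ∀ᵐ u : Fin k → ℝ, i ≠ j → u i ≠ u j := by
    intro i j
    by_cases hij : i = j
    · simp [hij]
    let L : (Fin k → ℝ) →ₗ[ℝ] ℝ :=
      LinearMap.proj (R := ℝ) (φ := fun _ => ℝ) i - LinearMap.proj (R := ℝ) (φ := fun _ => ℝ) j
    have hL : L.ker ≠ ⊤ := by
      intro htop
      have h1 : L (Pi.single i 1) = 0 := by
        rw [LinearMap.ker_eq_top.1 htop, LinearMap.zero_apply]
      simp [L, Ne.symm hij] at h1
    have h0 := Measure.addHaar_submodule (volume : Measure (Fin k → ℝ)) _ hL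
    filter_upwards [measure_eq_zero_iff_ae_notMem.1 h0] with u hu _ huij
    exact hu (by simp [L, huij])
  filter_upwards [ae_all_iff.2 fun i => ae_all_iff.2 (h i)] with u hu i j hij
  by_contra hne
  exact hu i j hne hij

/-- The product `∏ j, g (u j)` has the same integral over every ordering of the coordinates. -/
theorem setIntegral_strictMono_comp {k : ℕ} (g : ℝ → ℝ) (σ : Equiv.Perm (Fin k)) :
    ∫ u in {u : Fin k → ℝ | StrictMono (u ∘ σ)}, ∏ j, g (u j) =
      ∫ u in {u : Fin k → ℝ | StrictMono u}, ∏ j, g (u j) := by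
  let e := MeasurableEquiv.piCongrLeft (fun _ : Fin k => ℝ) σ.symm
  have he : ∀ u, e u = u ∘ σ := by
    intro u
    ext i
    obtain ⟨j, rfl⟩ := σ.symm.surjective i
    simp only [e, MeasurableEquiv.coe_piCongrLeft, Equiv.piCongrLeft_apply_apply]
    simp
  have hmp : MeasurePreserving e := volume_measurePreserving_piCongrLeft (fun _ => ℝ) σ.symm
  rw [← hmp.setIntegral_preimage_emb e.measurableEmbedding _ {u | StrictMono u}]
  have hprod : ∀ u : Fin k → ℝ, ∏ j, g ((u ∘ σ) j) = ∏ j, g (u j) :=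
    fun u => Equiv.prod_comp σ fun j => g (u j)
  simp only [Set.preimage_ofPred_eq, he, hprod]

/-- The integral of `∏ j, g (u j)` over the increasing tuples is `(∫ g) ^ k / k!`. -/
theorem setIntegral_strictMono_prod {g : ℝ → ℝ} (hg : Integrable g) (k : ℕ) :
    ∫ u in {u : Fin k → ℝ | StrictMono u}, ∏ j, g (u j) =
      (∫ t, g t) ^ k / (Nat.factorial k) := by
  have hint : Integrable fun u : Fin k → ℝ => ∏ j, g (u j) :=
    Integrable.fintype_prod fun _ => hg
  have hcover : (⋃ σ : Equiv.Perm (Fin k), {u : Fin k → ℝ | StrictMono (u ∘ σ)}) =ᵐ[volume]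
      Set.univ := by
    rw [Filter.eventuallyEq_univ]
    filter_upwards [ae_injective k] with u hu
    exact Set.mem_iUnion.2 ⟨Tuple.sort u, (Tuple.monotone_sort u).strictMono_of_injective
      (hu.comp (Tuple.sort u).injective)⟩
  have hsum := integral_iUnion_fintype (μ := volume) (f := fun u : Fin k → ℝ => ∏ j, g (u j))
    measurableSet_strictMono_comp
    (fun σ τ hne => Set.disjoint_left.2 fun u hσ hτ => hne (eq_of_strictMono_comp hσ hτ))
    (fun _ => hint.integrableOn)
  rw [setIntegral_congr_set hcover, setIntegral_univ, integral_fintype_prod_volume_eq_prod] at hsum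
  simp only [setIntegral_strictMono_comp, Finset.sum_const, Finset.prod_const, Finset.card_univ, Fintype.card_perm,
    Fintype.card_fin, nsmul_eq_mul] at hsum
  rw [hsum, mul_div_cancel_left₀ _ (Nat.cast_ne_zero.2 k.factorial_ne_zero)]

/-- **The signature of a one-dimensional path.**  If `X : ℝ → ℝ` is continuously
differentiable on `[S, T]` (with derivative `X'`), then for every `k ≥ 1` the
integral of `∏_j X'(u_j)` over the open simplex
`{u : S < u₁ < ⋯ < u_k < T}` equals `(X T − X S)^k / k!`. -/
theorem one_dim_signature (S T : ℝ) (hST : S < T) (k : ℕ) (hk : 1 ≤ k)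
    (X X' : ℝ → ℝ)
    (hX : ∀ t ∈ Set.Icc S T, HasDerivAt X (X' t) t)
    (hX'c : ContinuousOn X' (Set.Icc S T)) :
    (∫ u in {u : Fin k → ℝ | StrictMono u ∧ ∀ i, u i ∈ Set.Ioo S T},
        ∏ j, X' (u j))
      = (X T - X S) ^ k / (Nat.factorial k) := by
  have hg : Integrable ((Set.Ioo S T).indicator X') :=
    (integrable_indicator_iff measurableSet_Ioo).2
      (hX'c.integrableOn_Icc.mono_set Set.Ioo_subset_Icc_self)
  have hFTC : ∫ t, (Set.Ioo S T).indicator X' t = X T - X S := by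
    rw [integral_indicator measurableSet_Ioo, ← integral_Ioc_eq_integral_Ioo,
      ← intervalIntegral.integral_of_le hST.le]
    rw [← Set.uIcc_of_le hST.le] at hX hX'c
    exact intervalIntegral.integral_eq_sub_of_hasDerivAt hX hX'c.intervalIntegrable
  have hbox : MeasurableSet {u : Fin k → ℝ | ∀ i, u i ∈ Set.Ioo S T} := by
    rw [Set.ofPred_forall]
    exact MeasurableSet.iInter fun i => measurable_pi_apply i measurableSet_Ioo
  have hprod : (fun u : Fin k → ℝ => ∏ j, (Set.Ioo S T).indicator X' (u j)) =
      {u : Fin k → ℝ | ∀ i, u i ∈ Set.Ioo S T}.indicator fun u => ∏ j, X' (u j) := by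
    ext u
    by_cases hu : ∀ i, u i ∈ Set.Ioo S T
    · rw [Set.indicator_of_mem (show u ∈ {u : Fin k → ℝ | ∀ i, u i ∈ Set.Ioo S T} from hu)]
      exact Finset.prod_congr rfl fun j _ => Set.indicator_of_mem (hu j) X'
    · rw [Set.indicator_of_notMem (show u ∉ {u : Fin k → ℝ | ∀ i, u i ∈ Set.Ioo S T} from hu)]
      obtain ⟨i, hi⟩ := not_forall.1 hu
      exact Finset.prod_eq_zero (Finset.mem_univ i) (Set.indicator_of_notMem hi X')
  rw [← hFTC, ← setIntegral_strictMono_prod hg k, hprod, setIntegral_indicator hbox, Set.ofPred_and]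
end

section
/- (Chen's identity.) Let 0 ≤ s ≤ t be real numbers and let X : ℝ → ℝᵈ be continuously differentiable on [0, t]. Then for every n ≥ 1 and every multi-index I = (i₁, …, iₙ) with each i_j ∈ {1, …, d}, the coordinate iterated integral over [0, t] factorizes over the splitting point s: S^I_{[0,t]}(X) = Σ_{k=0}^{n} S^{(i₁,…,i_k)}_{[0,s]}(X) · S^{(i_{k+1},…,iₙ)}_{[s,t]}(X), where the iterated integral associated to the empty multi-index is 1. -/
open MeasureTheory

/-- The coordinate iterated integral `S^I_{[S,T]}` associated with a word
`I : List (Fin d)`, for a path with coordinate derivatives given by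
`D : ℝ → Fin d → ℝ`: the integral of `∏_j D (u_j) (I_j)` over the open simplex
`{u : S < u₁ < ⋯ < uₙ < T}` with `n = I.length`.  For the empty word it
equals `1`. -/
noncomputable def coordIterIntegralL (d : ℕ) (S T : ℝ) (D : ℝ → Fin d → ℝ)
    (I : List (Fin d)) : ℝ :=
  ∫ u in {u : Fin I.length → ℝ | StrictMono u ∧ ∀ i, u i ∈ Set.Ioo S T},
    ∏ j, D (u j) (I.get j)

/-- The open simplex `{u : S < u₁ < ⋯ < uₙ < T}`. -/
def openSimplex (n : ℕ) (S T : ℝ) : Set (Fin n → ℝ) :=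
  {u | StrictMono u ∧ ∀ i, u i ∈ Set.Ioo S T}

theorem measurableSet_openSimplex (n : ℕ) (S T : ℝ) :
    MeasurableSet (openSimplex n S T) := by
  have h : openSimplex n S T = (⋂ (i : Fin n) (j : Fin n) (_ : i < j), {u | u i < u j}) ∩
      ⋂ i : Fin n, {u | u i ∈ Set.Ioo S T} := by
    ext u
    simp [openSimplex, StrictMono]
  rw [h]
  refine (MeasurableSet.iInter fun i => .iInter fun j => .iInter fun _ => ?_).inter
    (.iInter fun i => ?_)
  · exact measurableSet_lt (measurable_pi_apply i) (measurable_pi_apply j)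
  · exact measurable_pi_apply i measurableSet_Ioo

theorem cons_mem_openSimplex {n : ℕ} {S T x : ℝ} {v : Fin n → ℝ} :
    (Fin.cons x v : Fin (n + 1) → ℝ) ∈ openSimplex (n + 1) S T ↔
      x ∈ Set.Ioo S T ∧ v ∈ openSimplex n x T := by
  simp only [openSimplex, Set.mem_ofPred_eq, StrictMono, Fin.forall_fin_succ, Fin.cons_zero,
    Fin.cons_succ, Set.mem_Ioo, Fin.succ_lt_succ_iff, Fin.succ_pos,
    Fin.not_lt_zero, false_imp_iff, true_and, forall_true_left]
  constructor
  · rintro ⟨⟨h1, h2⟩, h3, h4⟩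
    exact ⟨h3, h2, fun i => ⟨h1 i, (h4 i).2⟩⟩
  · rintro ⟨h3, h2, h4⟩
    exact ⟨⟨fun i => (h4 i).1, h2⟩, h3, fun i => ⟨h3.1.trans (h4 i).1, (h4 i).2⟩⟩

section

variable {d : ℕ} {D : ℝ → Fin d → ℝ}

/-- The product `∏_j D (u_j) (I_j)`, extended by zero outside the open simplex. -/
noncomputable def iterIntegrand (S T : ℝ) (D : ℝ → Fin d → ℝ) (I : List (Fin d)) :
    (Fin I.length → ℝ) → ℝ :=
  (openSimplex I.length S T).indicator fun u => ∏ j, D (u j) (I.get j)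

theorem coordIterIntegralL_eq_integral (S T : ℝ) (D : ℝ → Fin d → ℝ) (I : List (Fin d)) :
    coordIterIntegralL d S T D I = ∫ u, iterIntegrand S T D I u :=
  (integral_indicator (measurableSet_openSimplex _ _ _)).symm

theorem integrable_iterIntegrand {S T : ℝ} (hD : ContinuousOn D (Set.Icc S T))
    (I : List (Fin d)) : Integrable (iterIntegrand S T D I) := by
  rw [iterIntegrand, integrable_indicator_iff (measurableSet_openSimplex _ _ _)]
  have hK : IsCompact (Set.univ.pi fun _ : Fin I.length => Set.Icc S T) :=
    isCompact_univ_pi fun _ => isCompact_Icc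
  refine IntegrableOn.mono_set (ContinuousOn.integrableOn_compact hK ?_)
    fun u hu j _ => Set.Ioo_subset_Icc_self (hu.2 j)
  refine continuousOn_finsetProd _ fun j _ => ?_
  exact (continuousOn_pi.1 hD (I.get j)).comp (continuous_apply j).continuousOn
    fun u hu => hu j (Set.mem_univ j)

theorem iterIntegrand_cons (S T : ℝ) (D : ℝ → Fin d → ℝ) (i : Fin d) (I : List (Fin d))
    (x : ℝ) (v : Fin I.length → ℝ) :
    iterIntegrand S T D (i :: I) (Fin.cons x v : Fin (I.length + 1) → ℝ) =
      (Set.Ioo S T).indicator (fun y => D y i) x * iterIntegrand x T D I v := by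
  classical
  have h : (∏ j : Fin (I.length + 1),
      D ((Fin.cons x v : Fin (I.length + 1) → ℝ) j) ((i :: I).get j)) =
      D x i * ∏ j, D (v j) (I.get j) := by
    rw [Fin.prod_univ_succ]
    rfl
  have hmem := cons_mem_openSimplex (S := S) (T := T) (x := x) (v := v)
  simp only [iterIntegrand, Set.indicator_apply, List.length_cons, hmem, h]
  by_cases h1 : x ∈ Set.Ioo S T <;> by_cases h2 : v ∈ openSimplex I.length x T <;>
    simp [h1, h2]

theorem iterIntegrand_piFinSuccAbove_symm (S T : ℝ) (D : ℝ → Fin d → ℝ) (i : Fin d)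
    (I : List (Fin d)) (p : ℝ × (Fin I.length → ℝ)) :
    iterIntegrand S T D (i :: I)
      ((MeasurableEquiv.piFinSuccAbove (fun _ : Fin (I.length + 1) => ℝ) 0).symm p) =
      (Set.Ioo S T).indicator (fun y => D y i) p.1 * iterIntegrand p.1 T D I p.2 := by
  rw [← iterIntegrand_cons]
  congr 1
  exact Fin.insertNth_zero' p.1 p.2

theorem integrable_iterIntegrand_cons_prod {S T : ℝ} (hD : ContinuousOn D (Set.Icc S T))
    (i : Fin d) (I : List (Fin d)) :
    Integrable fun p : ℝ × (Fin I.length → ℝ) =>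
      (Set.Ioo S T).indicator (fun y => D y i) p.1 * iterIntegrand p.1 T D I p.2 := by
  have h := ((volume_preserving_piFinSuccAbove (fun _ : Fin (I.length + 1) => ℝ) 0).symm
    ).integrable_comp_of_integrable (integrable_iterIntegrand hD (i :: I))
  exact h.congr (.of_forall (iterIntegrand_piFinSuccAbove_symm S T D i I))

theorem integrableOn_mul_coordIterIntegralL {S T : ℝ} (hD : ContinuousOn D (Set.Icc S T))
    (i : Fin d) (I : List (Fin d)) :
    IntegrableOn (fun x => D x i * coordIterIntegralL d x T D I) (Set.Ioo S T) := by
  rw [← integrable_indicator_iff measurableSet_Ioo]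
  refine (integrable_iterIntegrand_cons_prod hD i I).integral_prod_left.congr
    (.of_forall fun x => ?_)
  simp only [integral_const_mul, ← coordIterIntegralL_eq_integral, Set.indicator_mul_left]

theorem coordIterIntegralL_cons {S T : ℝ} (hD : ContinuousOn D (Set.Icc S T))
    (i : Fin d) (I : List (Fin d)) :
    coordIterIntegralL d S T D (i :: I) =
      ∫ x in Set.Ioo S T, D x i * coordIterIntegralL d x T D I := by
  have e := (volume_preserving_piFinSuccAbove (fun _ : Fin (I.length + 1) => ℝ) 0).symm
  rw [← integral_indicator measurableSet_Ioo, coordIterIntegralL_eq_integral]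
  refine (e.integral_comp' (iterIntegrand S T D (i :: I))).symm.trans ?_
  refine (integral_congr_ae (.of_forall
    (iterIntegrand_piFinSuccAbove_symm S T D i I))).trans ?_
  refine (integral_prod _ (integrable_iterIntegrand_cons_prod hD i I)).trans ?_
  simp only [integral_const_mul, ← coordIterIntegralL_eq_integral, Set.indicator_mul_left]

theorem coordIterIntegralL_nil (S T : ℝ) (D : ℝ → Fin d → ℝ) :
    coordIterIntegralL d S T D [] = 1 := by
  have h : {u : Fin ([] : List (Fin d)).length → ℝ |
      StrictMono u ∧ ∀ i, u i ∈ Set.Ioo S T} = Set.univ :=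
    Set.eq_univ_of_forall fun u => ⟨fun i => i.elim0, fun i => i.elim0⟩
  rw [coordIterIntegralL, h, setIntegral_univ]
  change ∫ u : Fin 0 → ℝ, ∏ j : Fin 0, _ = _
  simp [volume_pi, Measure.real]

theorem setIntegral_Ioo_split {f : ℝ → ℝ} {a s t : ℝ} (has : a ≤ s) (hst : s ≤ t)
    (hf : IntegrableOn f (Set.Ioo a t)) :
    ∫ x in Set.Ioo a t, f x = (∫ x in Set.Ioo a s, f x) + ∫ x in Set.Ioo s t, f x := by
  rw [← integrableOn_Ioc_iff_integrableOn_Ioo] at hf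
  simp only [← integral_Ioc_eq_integral_Ioo]
  rw [← Set.Ioc_union_Ioc_eq_Ioc has hst] at hf ⊢
  exact setIntegral_union (Set.Ioc_disjoint_Ioc_of_le le_rfl) measurableSet_Ioc
    hf.left_of_union hf.right_of_union

/-- Chen's identity for continuous coordinate derivatives and an arbitrary initial time. -/
theorem coordIterIntegralL_eq_sum {a s t : ℝ} (has : a ≤ s) (hst : s ≤ t)
    (hD : ContinuousOn D (Set.Icc a t)) (I : List (Fin d)) :
    coordIterIntegralL d a t D I
      = ∑ k ∈ Finset.range (I.length + 1),
          coordIterIntegralL d a s D (I.take k) * coordIterIntegralL d s t D (I.drop k) := by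
  induction I generalizing a with
  | nil => simp [coordIterIntegralL_nil]
  | cons i I ih =>
    have hDs : ContinuousOn D (Set.Icc a s) := hD.mono (Set.Icc_subset_Icc_right hst)
    have hDt : ContinuousOn D (Set.Icc s t) := hD.mono (Set.Icc_subset_Icc_left has)
    rw [coordIterIntegralL_cons hD,
      setIntegral_Ioo_split has hst (integrableOn_mul_coordIterIntegralL hD i I),
      List.length_cons, Finset.sum_range_succ']
    simp only [List.take_succ_cons, List.drop_succ_cons, List.take_zero, List.drop_zero,
      coordIterIntegralL_nil, one_mul]
    rw [← coordIterIntegralL_cons hDt]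
    congr 1
    have h : ∀ x ∈ Set.Ioo a s, D x i * coordIterIntegralL d x t D I =
        ∑ k ∈ Finset.range (I.length + 1), D x i * coordIterIntegralL d x s D (I.take k) *
          coordIterIntegralL d s t D (I.drop k) := by
      intro x hx
      rw [ih hx.2.le (hD.mono (Set.Icc_subset_Icc_left hx.1.le)), Finset.mul_sum]
      simp only [mul_assoc]
    rw [setIntegral_congr_fun measurableSet_Ioo h, integral_finsetSum _ fun k _ =>
      (integrableOn_mul_coordIterIntegralL hDs i (I.take k)).mul_const _]
    simp only [integral_mul_const, coordIterIntegralL_cons hDs]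

end

/-- **Chen's identity.**  Let `0 ≤ s ≤ t` and let `X : ℝ → ℝᵈ` be continuously
differentiable on `[0, t]` with derivative `X'`.  Then for every word
`I = (i₁, …, iₙ)` with `n ≥ 1`, the iterated integral over `[0, t]` factorizes
over the splitting point `s`:
`S^I_{[0,t]} = ∑_{k=0}^{n} S^{(i₁,…,i_k)}_{[0,s]} ⋅ S^{(i_{k+1},…,iₙ)}_{[s,t]}`. -/
theorem chen_identity (d : ℕ) (s t : ℝ) (h0s : 0 ≤ s) (hst : s ≤ t)
    (X X' : ℝ → Fin d → ℝ)
    (hX : ∀ r ∈ Set.Icc (0 : ℝ) t, HasDerivAt X (X' r) r)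
    (hX'c : ContinuousOn X' (Set.Icc (0 : ℝ) t))
    (I : List (Fin d)) (hI : 1 ≤ I.length) :
    coordIterIntegralL d 0 t X' I
      = ∑ k ∈ Finset.range (I.length + 1),
          coordIterIntegralL d 0 s X' (I.take k)
            * coordIterIntegralL d s t X' (I.drop k) := by
  exact coordIterIntegralL_eq_sum h0s hst hX'c I
end

section
/- (Invariance of iterated integrals under time reparameterization.) Let S < T be real numbers, let X : ℝ → ℝᵈ be continuously differentiable on [S, T], and let λ : ℝ → ℝ be continuously differentiable on [S, T], non-decreasing on [S, T], with λ(S) = S and λ(T) = T. Then for every n ≥ 1 and every multi-index I = (i₁, …, iₙ) with each i_j ∈ {1, …, d}, the coordinate iterated integral of the reparameterized path X ∘ λ over [S, T] equals that of X: S^I_{[S,T]}(X ∘ λ) = S^I_{[S,T]}(X). -/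
open MeasureTheory

/-- The coordinate iterated integral `S^I_{[S,T]}` associated with the
multi-index `I : Fin n → Fin d`, for a path whose coordinate derivatives are
given by `D : ℝ → Fin d → ℝ`: the integral of `∏_j D (u_j) (I j)` over the
open simplex `{u : S < u₁ < ⋯ < uₙ < T}`. -/
noncomputable def coordIterIntegralD (d n : ℕ) (S T : ℝ) (D : ℝ → Fin d → ℝ)
    (I : Fin n → Fin d) : ℝ :=
  ∫ u in {u : Fin n → ℝ | StrictMono u ∧ ∀ i, u i ∈ Set.Ioo S T},
    ∏ j, D (u j) (I j)

/-- A product of measures with real densities has the product density. -/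
theorem pi_withDensity_ofReal {ι : Type*} [Fintype ι] {α : ι → Type*}
    [∀ i, MeasurableSpace (α i)] (μ : ∀ i, Measure (α i)) [∀ i, SigmaFinite (μ i)]
    {g : ∀ i, α i → ℝ} (hg : ∀ i, Integrable (g i) (μ i)) (hg0 : ∀ i x, 0 ≤ g i x) :
    Measure.pi (fun i => (μ i).withDensity fun x => ENNReal.ofReal (g i x)) =
      (Measure.pi μ).withDensity fun u => ENNReal.ofReal (∏ i, g i (u i)) := by
  have (i : ι) : IsFiniteMeasure ((μ i).withDensity fun x => ENNReal.ofReal (g i x)) :=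
    isFiniteMeasure_withDensity_ofReal (hg i).2
  refine Measure.pi_eq fun s hs => ?_
  rw [withDensity_apply _ (MeasurableSet.univ_pi hs), Measure.restrict_pi_pi,
    ← ofReal_integral_eq_lintegral_ofReal (Integrable.fintype_prod_dep fun i => (hg i).restrict)
      (ae_of_all _ fun u => Finset.prod_nonneg fun i _ => hg0 i (u i)),
    integral_fintype_prod_eq_prod,
    ENNReal.ofReal_prod_of_nonneg fun i _ => integral_nonneg (hg0 i)]
  refine Finset.prod_congr rfl fun i _ => ?_
  rw [withDensity_apply _ (hs i),
    ofReal_integral_eq_lintegral_ofReal (hg i).restrict (ae_of_all _ (hg0 i))]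

/-- Almost every vector has pairwise distinct coordinates. -/
theorem ae_injective_volume {ι : Type*} [Fintype ι] :
    ∀ᵐ v : ι → ℝ, Function.Injective v := by
  classical
  have h (i j : ι) (hij : i ≠ j) : ∀ᵐ v : ι → ℝ, v i ≠ v j := by
    let K : Submodule ℝ (ι → ℝ) :=
      LinearMap.ker (LinearMap.proj (R := ℝ) (φ := fun _ : ι => ℝ) i - LinearMap.proj j)
    have hK : K ≠ ⊤ := fun htop => by
      have hmem : Pi.single i (1 : ℝ) ∈ K := htop ▸ Submodule.mem_top
      simp [K, hij.symm] at hmem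
    filter_upwards [measure_eq_zero_iff_ae_notMem.1 (Measure.addHaar_submodule volume K hK)]
      with v hv hvij
    exact hv (by simp [K, hvij])
  have h' : ∀ᵐ v : ι → ℝ, ∀ i j, i ≠ j → v i ≠ v j := by
    simp only [ae_all_iff]
    exact h
  filter_upwards [h'] with v hv i j hij
  exact not_imp_not.1 (hv i j) hij

/-- A monotone `C¹` map of `[S, T]` onto itself, with derivative as density, preserves Lebesgue
measure on `[S, T]`. -/
theorem measurePreserving_withDensity_deriv {S T : ℝ} (hST : S ≤ T) {f f' : ℝ → ℝ}
    (hf : ∀ u ∈ Set.Icc S T, HasDerivWithinAt f (f' u) (Set.Icc S T) u)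
    (hmono : Monotone f) (hS : f S = S) (hT : f T = T) :
    MeasurePreserving f
      ((volume.restrict (Set.Icc S T)).withDensity fun x => ENNReal.ofReal (f' x))
      (volume.restrict (Set.Icc S T)) := by
  refine ⟨hmono.measurable, Measure.ext fun B hB => ?_⟩
  have himg : f '' Set.Icc S T = Set.Icc S T := by
    have hc : ContinuousOn f (Set.Icc S T) := fun u hu => (hf u hu).continuousWithinAt
    rw [hc.image_Icc_of_monotoneOn hST (hmono.monotoneOn _), hS, hT]
  have key := lintegral_image_eq_lintegral_deriv_mul_of_monotoneOn measurableSet_Icc hf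
    (hmono.monotoneOn _) (B.indicator 1)
  rw [himg, lintegral_indicator_one hB] at key
  rw [Measure.map_apply hmono.measurable hB,
    withDensity_apply _ (hmono.measurable hB), key,
    ← lintegral_indicator (hmono.measurable hB)]
  refine lintegral_congr fun x => ?_
  by_cases hx : f x ∈ B <;> simp [hx]

theorem measurableSet_strictMono {ι : Type*} [Countable ι] [Preorder ι] :
    MeasurableSet {u : ι → ℝ | StrictMono u} := by
  simp only [StrictMono, Set.ofPred_forall]
  exact .iInter fun i => .iInter fun j => .iInter fun _ =>
    measurableSet_lt (measurable_pi_apply i) (measurable_pi_apply j)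

/-- The iterated integral as an integral against the product of Lebesgue measures on `[S, T]`; it
only depends on the values of the integrand on `[S, T]`. -/
theorem coordIterIntegralD_eq_pi {d n : ℕ} {S T : ℝ} {D E : ℝ → Fin d → ℝ}
    (hDE : Set.EqOn D E (Set.Icc S T)) (I : Fin n → Fin d) :
    coordIterIntegralD d n S T D I =
      ∫ u, {u : Fin n → ℝ | StrictMono u}.indicator (fun u => ∏ j, E (u j) (I j)) u
        ∂Measure.pi (fun _ => volume.restrict (Set.Icc S T)) := by
  have hset : {u : Fin n → ℝ | StrictMono u ∧ ∀ i, u i ∈ Set.Ioo S T} =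
      {u | StrictMono u} ∩ Set.univ.pi fun _ => Set.Ioo S T := by
    ext u
    simp
  have hIoo : volume.restrict (Set.Icc S T) = volume.restrict (Set.Ioo S T) :=
    (Measure.restrict_congr_set Ioo_ae_eq_Icc).symm
  rw [integral_indicator measurableSet_strictMono, hIoo, ← Measure.restrict_pi_pi,
    Measure.restrict_restrict measurableSet_strictMono, coordIterIntegralD, hset]
  refine setIntegral_congr_fun
    (measurableSet_strictMono.inter (.univ_pi fun _ => measurableSet_Ioo)) fun u hu => ?_
  refine Finset.prod_congr rfl fun j _ => ?_
  rw [hDE (Set.Ioo_subset_Icc_self (hu.2 j trivial))]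

/-- **Invariance of iterated integrals under time reparameterization.**
Let `X : ℝ → ℝᵈ` be continuously differentiable on `[S, T]` with derivative
`X'`, and let `Λ` be a continuously differentiable non-decreasing map of
`[S, T]` onto itself with `Λ S = S`, `Λ T = T`.  If `D` is the derivative of
the reparameterized path `X ∘ Λ` on `[S, T]`, then for every `n ≥ 1` and every
multi-index `I`, the iterated integral of `X ∘ Λ` equals that of `X`. -/
theorem iterated_integral_reparam_invariance (d : ℕ) (S T : ℝ) (hST : S < T)
    (X X' : ℝ → Fin d → ℝ) (Λ Λ' : ℝ → ℝ)
    (hX : ∀ u ∈ Set.Icc S T, HasDerivAt X (X' u) u)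
    (hX'c : ContinuousOn X' (Set.Icc S T))
    (hΛ : ∀ u ∈ Set.Icc S T, HasDerivAt Λ (Λ' u) u)
    (hΛ'c : ContinuousOn Λ' (Set.Icc S T))
    (hmono : MonotoneOn Λ (Set.Icc S T))
    (hΛS : Λ S = S) (hΛT : Λ T = T)
    (D : ℝ → Fin d → ℝ)
    (hD : ∀ u ∈ Set.Icc S T, HasDerivAt (fun r => X (Λ r)) (D u) u) :
    ∀ n : ℕ, 1 ≤ n → ∀ I : Fin n → Fin d,
      coordIterIntegralD d n S T D I = coordIterIntegralD d n S T X' I := by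
  intro n _ I
  set μ : Measure ℝ := volume.restrict (Set.Icc S T) with hμ
  let p : ℝ → ℝ := fun x => (Set.projIcc S T hST.le x : ℝ)
  have hp : Continuous p := continuous_subtype_val.comp continuous_projIcc
  have hpm (x : ℝ) : p x ∈ Set.Icc S T := (Set.projIcc S T hST.le x).2
  have hpe {x : ℝ} (hx : x ∈ Set.Icc S T) : p x = x := by
    simp [p, Set.projIcc_of_mem hST.le hx]
  have hmaps {x : ℝ} (hx : x ∈ Set.Icc S T) : Λ x ∈ Set.Icc S T := by
    have h₁ := hmono (Set.left_mem_Icc.2 hST.le) hx hx.1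
    have h₂ := hmono hx (Set.right_mem_Icc.2 hST.le) hx.2
    rw [hΛS] at h₁
    rw [hΛT] at h₂
    exact ⟨h₁, h₂⟩
  let L : ℝ → ℝ := Λ ∘ p
  let g : ℝ → ℝ := Λ' ∘ p
  let Y : ℝ → Fin d → ℝ := X' ∘ p
  have hg : Continuous g := hΛ'c.comp_continuous hp hpm
  have hY : Continuous Y := hX'c.comp_continuous hp hpm
  have hL : Monotone L := fun x y hxy =>
    hmono (hpm x) (hpm y) (Set.monotone_projIcc hST.le hxy)
  have hLe {x : ℝ} (hx : x ∈ Set.Icc S T) : L x = Λ x := congrArg Λ (hpe hx)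
  have hge {x : ℝ} (hx : x ∈ Set.Icc S T) : g x = Λ' x := congrArg Λ' (hpe hx)
  have hYe {x : ℝ} (hx : x ∈ Set.Icc S T) : Y x = X' x := congrArg X' (hpe hx)
  have hg0 (x : ℝ) : 0 ≤ g x :=
    (hΛ _ (hpm x)).hasDerivWithinAt.nonneg_of_monotoneOn
      ((uniqueDiffOn_Icc hST _ (hpm x)).accPt) hmono
  have hLp : MeasurePreserving L (μ.withDensity fun x => ENNReal.ofReal (g x)) μ := by
    refine measurePreserving_withDensity_deriv hST.le (fun u hu => ?_) hL
      ((hLe (Set.left_mem_Icc.2 hST.le)).trans hΛS)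
      ((hLe (Set.right_mem_Icc.2 hST.le)).trans hΛT)
    rw [hge hu]
    exact (hΛ u hu).hasDerivWithinAt.congr (fun x hx => hLe hx) (hLe hu)
  have hgi : Integrable g μ := hg.continuousOn.integrableOn_Icc
  have : IsFiniteMeasure (μ.withDensity fun x => ENNReal.ofReal (g x)) :=
    isFiniteMeasure_withDensity_ofReal hgi.2
  have hpi := measurePreserving_pi (fun _ : Fin n => μ.withDensity fun x => ENNReal.ofReal (g x))
    (fun _ => μ) (fun _ => hLp)
  have hinj := hpi.quasiMeasurePreserving.ae (p := Function.Injective) (by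
    rw [hμ, ← Measure.restrict_pi_pi]
    exact ae_restrict_of_ae ae_injective_volume)
  have hDE : Set.EqOn D (fun x => g x • Y (L x)) (Set.Icc S T) := fun x hx => by
    have h := (hX (Λ x) (hmaps hx)).scomp x (hΛ x hx)
    have h' := (hD x hx).unique h
    simp only [h', hge hx, hLe hx, hYe (hmaps hx)]
  have hF : Measurable ({u : Fin n → ℝ | StrictMono u}.indicator
      fun u => ∏ j, Y (u j) (I j)) := by
    refine Measurable.indicator ?_ measurableSet_strictMono
    exact (continuous_finsetProd _ fun j _ =>
      (continuous_apply (I j)).comp (hY.comp (continuous_apply j))).measurable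
  have hYE : Set.EqOn X' Y (Set.Icc S T) := fun x hx => (hYe hx).symm
  rw [coordIterIntegralD_eq_pi hDE, coordIterIntegralD_eq_pi hYE, ← hμ]
  have hgm : Measurable fun u : Fin n → ℝ => ENNReal.ofReal (∏ i, g (u i)) :=
    (continuous_finsetProd _ fun j _ => hg.comp (continuous_apply j)).measurable.ennreal_ofReal
  calc
    ∫ u, {u : Fin n → ℝ | StrictMono u}.indicator
          (fun u => ∏ j, (g (u j) • Y (L (u j))) (I j)) u ∂Measure.pi (fun _ => μ)
      = ∫ u, {u : Fin n → ℝ | StrictMono u}.indicator (fun u => ∏ j, Y (L (u j)) (I j)) u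
        ∂Measure.pi (fun _ : Fin n => μ.withDensity fun x => ENNReal.ofReal (g x)) := by
      rw [pi_withDensity_ofReal (fun _ => μ) (fun _ => hgi) (fun _ => hg0),
        integral_withDensity_eq_integral_toReal_smul hgm
          (ae_of_all _ fun _ => ENNReal.ofReal_lt_top)]
      refine integral_congr_ae (ae_of_all _ fun u => ?_)
      by_cases hu : StrictMono u
      · simp [hu, Finset.prod_mul_distrib,
          ENNReal.toReal_ofReal (Finset.prod_nonneg fun j _ => hg0 (u j))]
      · simp [hu]
    _ = ∫ u, {u : Fin n → ℝ | StrictMono u}.indicator (fun u => ∏ j, Y (u j) (I j))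
          (fun i => L (u i))
        ∂Measure.pi (fun _ : Fin n => μ.withDensity fun x => ENNReal.ofReal (g x)) := by
      refine integral_congr_ae ?_
      filter_upwards [hinj] with u hu
      have hiff : StrictMono u ↔ StrictMono fun i => L (u i) :=
        ⟨fun h => (hL.comp h.monotone).strictMono_of_injective hu,
          fun h i j hij => hL.reflect_lt (h hij)⟩
      by_cases h : StrictMono u
      · simp [h, hiff.1 h]
      · simp [h, mt hiff.2 h]
    _ = _ := by
      rw [← integral_map hpi.measurable.aemeasurable hF.aestronglyMeasurable, hpi.map_eq]
end

section
/- (Shuffle product identity.) Let S < T be real numbers and let X : ℝ → ℝᵈ be continuously differentiable on [S, T]. Let I = (i₁, …, i_m) and J = (j₁, …, j_n) be multi-indices with entries in {1, …, d}. Then the product of the two coordinate iterated integrals equals the sum over all (m, n)-shuffles of iterated integrals of interleaved words: S^I_{[S,T]}(X) · S^J_{[S,T]}(X) = Σ_{A} S^{K_A}_{[S,T]}(X), where the sum ranges over all subsets A ⊆ {1, …, m+n} of cardinality m, and K_A is the multi-index of length m + n whose entries at the positions of A, taken in increasing order, are i₁, …, i_m and whose entries at the positions of the complement of A, taken in increasing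 order, are j₁, …, j_n. -/
open MeasureTheory

/-- Given words `I : Fin m → Fin d`, `J : Fin n → Fin d` and a set
`A ⊆ {1, …, m + n}` of cardinality `m`, the interleaved word `K_A` of length
`m + n`: its entries at the positions of `A`, taken in increasing order, are
those of `I`, and its entries at the positions of the complement of `A`, taken
in increasing order, are those of `J`. -/
noncomputable def shuffleWord {d m n : ℕ} (I : Fin m → Fin d) (J : Fin n → Fin d)
    (A : Finset (Fin (m + n))) (hA : A.card = m) : Fin (m + n) → Fin d :=
  fun p =>
    if h : p ∈ A then I ((A.orderIsoOfFin hA).symm ⟨p, h⟩)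
    else J ((Aᶜ.orderIsoOfFin
        (by simp [Finset.card_compl, hA])).symm ⟨p, by simpa using h⟩)

theorem ae_injective_pi {ι : Type*} [Fintype ι] : ∀ᵐ u : ι → ℝ, Function.Injective u := by
  have key (i j : ι) (hij : i ≠ j) : ∀ᵐ u : ι → ℝ, u i ≠ u j := by
    classical
    let s : Submodule ℝ (ι → ℝ) :=
      LinearMap.ker
      (LinearMap.proj (R := ℝ) (φ := fun _ : ι => ℝ) i - LinearMap.proj j)
    have hs : s ≠ ⊤ := by
      intro h
      have : Pi.single i (1 : ℝ) ∈ s := h ▸ Submodule.mem_top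
      simp [s, hij.symm] at this
    filter_upwards [measure_eq_zero_iff_ae_notMem.mp (Measure.addHaar_submodule volume s hs)]
      with u hu h
    exact hu (by simp [s, h])
  have h : ∀ᵐ u : ι → ℝ, ∀ i j, i ≠ j → u i ≠ u j := by
    simp only [ae_all_iff]
    exact key
  filter_upwards [h] with u hu i j
  exact not_imp_not.mp (hu i j)

theorem measurableSet_strictMono_comp_s10 {ι κ : Type*} [Preorder κ] [Countable κ] (f : κ → ι) :
    MeasurableSet {u : ι → ℝ | StrictMono (u ∘ f)} := by
  simp only [StrictMono, Function.comp_apply, Set.ofPred_forall]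
  refine .iInter fun a => .iInter fun b => .iInter fun _ => ?_
  exact measurableSet_lt (measurable_pi_apply _) (measurable_pi_apply _)

/-- The points of the cube `(S, T)^ι` whose coordinates increase in the order given by `e`. -/
def orderedRegion {ι : Type*} {N : ℕ} (S T : ℝ) (e : ι ≃ Fin N) : Set (ι → ℝ) :=
  {u | StrictMono (u ∘ e.symm) ∧ ∀ i, u i ∈ Set.Ioo S T}

theorem measurableSet_orderedRegion {ι : Type*} [Countable ι] {N : ℕ} (S T : ℝ)
    (e : ι ≃ Fin N) : MeasurableSet (orderedRegion S T e) := by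
  have h : MeasurableSet {u : ι → ℝ | ∀ i, u i ∈ Set.Ioo S T} := by
    rw [Set.ofPred_forall]
    exact .iInter fun i => measurable_pi_apply i measurableSet_Ioo
  exact (measurableSet_strictMono_comp_s10 e.symm).inter h

theorem coordIterIntegralD_eq_setIntegral_orderedRegion {ι : Type*} [Fintype ι] {d N : ℕ}
    (S T : ℝ) (D : ℝ → Fin d → ℝ) (K : Fin N → Fin d) (e : ι ≃ Fin N) :
    coordIterIntegralD d N S T D K =
      ∫ u in orderedRegion S T e, ∏ i, D (u i) (K (e i)) := by
  have hφ (u : ι → ℝ) : MeasurableEquiv.piCongrLeft (fun _ => ℝ) e u = u ∘ e.symm := by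
    ext p
    obtain ⟨i, rfl⟩ := e.surjective p
    simp [MeasurableEquiv.coe_piCongrLeft, Equiv.piCongrLeft_apply_apply]
  rw [coordIterIntegralD,
    ← (volume_measurePreserving_piCongrLeft (fun _ => ℝ) e).setIntegral_preimage_emb
      (MeasurableEquiv.measurableEmbedding _)]
  congr 1
  · congr 1
    ext u
    simp only [orderedRegion, Set.mem_preimage, Set.mem_ofPred_eq, hφ, Function.comp_apply,
      e.symm.forall_congr_left, Equiv.symm_symm, Equiv.symm_apply_apply]
  · ext u
    simp [hφ, ← e.prod_comp]

theorem integrableOn_prod_coord {ι : Type*} [Fintype ι] {d : ℕ} {S T : ℝ}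
    {D : ℝ → Fin d → ℝ} (hD : ContinuousOn D (Set.Icc S T)) (K : ι → Fin d) :
    IntegrableOn (fun u : ι → ℝ => ∏ i, D (u i) (K i)) {u | ∀ i, u i ∈ Set.Icc S T} := by
  have hset : {u : ι → ℝ | ∀ i, u i ∈ Set.Icc S T} = Set.univ.pi fun _ => Set.Icc S T := by
    ext
    simp only [Set.mem_ofPred_eq, Set.mem_univ_pi]
  refine ContinuousOn.integrableOn_compact ?_ (continuousOn_finsetProd _ fun i _ => ?_)
  · rw [hset]
    exact isCompact_univ_pi fun _ => isCompact_Icc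
  · exact ((continuous_apply (K i)).comp_continuousOn hD).comp
      (continuous_apply i).continuousOn fun u hu => hu i

theorem setIntegral_mul_setIntegral_eq_setIntegral_sum {m n : ℕ} (f : (Fin m → ℝ) → ℝ)
    (g : (Fin n → ℝ) → ℝ) (s : Set (Fin m → ℝ)) (t : Set (Fin n → ℝ)) :
    (∫ x in s, f x) * ∫ y in t, g y =
      ∫ u in {u : Fin m ⊕ Fin n → ℝ | u ∘ Sum.inl ∈ s ∧ u ∘ Sum.inr ∈ t},
        f (u ∘ Sum.inl) * g (u ∘ Sum.inr) := by
  rw [← setIntegral_prod_mul, ← Measure.volume_eq_prod,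
    ← (volume_measurePreserving_sumPiEquivProdPi
      fun _ : Fin m ⊕ Fin n => ℝ).setIntegral_preimage_emb (MeasurableEquiv.measurableEmbedding _)]
  rfl

theorem card_compl_of_card_eq {m n : ℕ} {A : Finset (Fin (m + n))} (hA : A.card = m) :
    Aᶜ.card = n := by
  simp [Finset.card_compl, hA]

/-- The bijection which sends the two summands increasingly onto `A` and onto its complement. -/
def shuffleEquiv {m n : ℕ} (A : Finset (Fin (m + n))) (hA : A.card = m) :
    Fin m ⊕ Fin n ≃ Fin (m + n) :=
  finSumEquivOfFinset hA (card_compl_of_card_eq hA)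

theorem shuffleWord_shuffleEquiv {d m n : ℕ} (I : Fin m → Fin d) (J : Fin n → Fin d)
    (A : Finset (Fin (m + n))) (hA : A.card = m) (k : Fin m ⊕ Fin n) :
    shuffleWord I J A hA (shuffleEquiv A hA k) = Sum.elim I J k := by
  rcases k with i | j
  · have h : shuffleEquiv A hA (Sum.inl i) ∈ A := A.orderEmbOfFin_mem hA i
    exact (dif_pos h).trans <|
      congrArg I ((A.orderIsoOfFin hA).symm_apply_apply i)
  · have hc := card_compl_of_card_eq hA
    have h : shuffleEquiv A hA (Sum.inr j) ∉ A := Finset.mem_compl.mp (Aᶜ.orderEmbOfFin_mem hc j)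
    exact (dif_neg h).trans <|
      congrArg J ((Aᶜ.orderIsoOfFin hc).symm_apply_apply j)

theorem strictMono_shuffleEquiv_inl {m n : ℕ} (A : Finset (Fin (m + n))) (hA : A.card = m) :
    StrictMono fun i => shuffleEquiv A hA (Sum.inl i) :=
  (A.orderEmbOfFin hA).strictMono

theorem strictMono_shuffleEquiv_inr {m n : ℕ} (A : Finset (Fin (m + n))) (hA : A.card = m) :
    StrictMono fun j => shuffleEquiv A hA (Sum.inr j) :=
  (Aᶜ.orderEmbOfFin (card_compl_of_card_eq hA)).strictMono

theorem shuffleEquiv_injective {m n : ℕ} {A B : Finset (Fin (m + n))} {hA : A.card = m}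
    {hB : B.card = m} (h : shuffleEquiv A hA = shuffleEquiv B hB) : A = B := by
  have h' : (A.orderEmbOfFin hA : Fin m → Fin (m + n)) = B.orderEmbOfFin hB :=
    funext fun i => DFunLike.congr_fun h (Sum.inl i)
  rw [← Finset.coe_inj, ← A.range_orderEmbOfFin hA, h', B.range_orderEmbOfFin hB]

/-- Every bijection which is increasing on both summands is a shuffle. -/
theorem exists_eq_shuffleEquiv {m n : ℕ} (e : Fin m ⊕ Fin n ≃ Fin (m + n))
    (hl : StrictMono (e ∘ Sum.inl)) (hr : StrictMono (e ∘ Sum.inr)) :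
    ∃ A : Finset (Fin (m + n)), ∃ hA : A.card = m, e = shuffleEquiv A hA := by
  let A : Finset (Fin (m + n)) := Finset.univ.image (e ∘ Sum.inl)
  have hA : A.card = m := by
    simp [A, Finset.card_image_of_injective _ hl.injective]
  refine ⟨A, hA, Equiv.ext fun k => ?_⟩
  rcases k with i | j
  · exact congrFun (Finset.orderEmbOfFin_unique hA (by simp [A]) hl) i
  · exact congrFun (Finset.orderEmbOfFin_unique (card_compl_of_card_eq hA) (by simp [A]) hr) j

theorem exists_equiv_strictMono {ι : Type*} {N : ℕ} (e₀ : ι ≃ Fin N) {u : ι → ℝ}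
    (hu : Function.Injective u) : ∃ e : ι ≃ Fin N, StrictMono (u ∘ e.symm) := by
  let σ := Tuple.sort (u ∘ e₀.symm)
  refine ⟨e₀.trans σ.symm, ?_⟩
  exact (Tuple.monotone_sort (u ∘ e₀.symm)).strictMono_of_injective
    ((hu.comp e₀.symm.injective).comp σ.injective)

theorem equiv_eq_of_strictMono {ι : Type*} {N : ℕ} {e e' : ι ≃ Fin N} {u : ι → ℝ}
    (he : StrictMono (u ∘ e.symm)) (he' : StrictMono (u ∘ e'.symm)) : e = e' := by
  have hu : Function.Injective u := (e.symm.injective_comp u).mp he.injective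
  have h : u ∘ e.symm = u ∘ e'.symm :=
    (he.range_inj he').mp (by simp [EquivLike.range_comp])
  exact Equiv.symm_bijective.injective (Equiv.ext fun p => hu (congrFun h p))

/-- An injective point of the cube has increasing coordinates on both summands exactly when it
lies in the region of some shuffle. -/
theorem exists_mem_orderedRegion_iff {m n : ℕ} {S T : ℝ} {u : Fin m ⊕ Fin n → ℝ}
    (hu : Function.Injective u) :
    (∃ A : Finset (Fin (m + n)), ∃ hA : A.card = m, u ∈ orderedRegion S T (shuffleEquiv A hA)) ↔
      (StrictMono (u ∘ Sum.inl) ∧ ∀ i, (u ∘ Sum.inl) i ∈ Set.Ioo S T) ∧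
        StrictMono (u ∘ Sum.inr) ∧ ∀ j, (u ∘ Sum.inr) j ∈ Set.Ioo S T := by
  constructor
  · rintro ⟨A, hA, hmono, hmem⟩
    refine ⟨⟨?_, fun i => hmem _⟩, ?_, fun j => hmem _⟩
    · simpa [Function.comp_def] using hmono.comp (strictMono_shuffleEquiv_inl A hA)
    · simpa [Function.comp_def] using hmono.comp (strictMono_shuffleEquiv_inr A hA)
  · rintro ⟨⟨hl, hl'⟩, hr, hr'⟩
    obtain ⟨e, he⟩ := exists_equiv_strictMono finSumFinEquiv hu
    obtain ⟨A, hA, rfl⟩ := exists_eq_shuffleEquiv e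
      (fun i j hij => he.lt_iff_lt.mp (by simpa using hl hij))
      (fun i j hij => he.lt_iff_lt.mp (by simpa using hr hij))
    exact ⟨A, hA, he, Sum.forall.mpr ⟨hl', hr'⟩⟩

/-- **Shuffle product identity.**  For a path `X : ℝ → ℝᵈ` continuously
differentiable on `[S, T]` with derivative `X'`, and words `I` of length `m`
and `J` of length `n`, the product of the two coordinate iterated integrals
equals the sum, over all subsets `A` of `{1, …, m + n}` of cardinality `m`, of
the iterated integrals of the interleaved words `K_A`. -/
theorem shuffle_product_identity (d m n : ℕ) (S T : ℝ) (hST : S < T)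
    (X X' : ℝ → Fin d → ℝ)
    (hX : ∀ t ∈ Set.Icc S T, HasDerivAt X (X' t) t)
    (hX'c : ContinuousOn X' (Set.Icc S T))
    (I : Fin m → Fin d) (J : Fin n → Fin d) :
    coordIterIntegralD d m S T X' I * coordIterIntegralD d n S T X' J
      = ∑ A ∈ (Finset.powersetCard m (Finset.univ : Finset (Fin (m + n)))).attach,
          coordIterIntegralD d (m + n) S T X'
            (shuffleWord I J A.1 (Finset.mem_powersetCard.mp A.2).2) := by
  have hsum (A : Finset (Fin (m + n))) (hA : A.card = m) :
      coordIterIntegralD d (m + n) S T X' (shuffleWord I J A hA) =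
        ∫ u in orderedRegion S T (shuffleEquiv A hA), ∏ k, X' (u k) (Sum.elim I J k) := by
    simp_rw [coordIterIntegralD_eq_setIntegral_orderedRegion S T X' _ (shuffleEquiv A hA),
      shuffleWord_shuffleEquiv]
  simp_rw [hsum]
  rw [← integral_biUnion_finset _ (fun A _ => measurableSet_orderedRegion S T _)]
  · rw [coordIterIntegralD, coordIterIntegralD, setIntegral_mul_setIntegral_eq_setIntegral_sum]
    simp only [Fintype.prod_sum_type, Sum.elim_inl, Sum.elim_inr, Function.comp_apply]
    refine setIntegral_congr_set (Filter.eventuallyEq_set.mpr ?_)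
    filter_upwards [ae_injective_pi] with u hu
    refine (exists_mem_orderedRegion_iff hu).symm.trans ?_
    simp [Finset.mem_powersetCard]
  · intro A _ B _ hAB
    refine Set.disjoint_left.mpr fun u huA huB => hAB (Subtype.ext ?_)
    exact shuffleEquiv_injective (equiv_eq_of_strictMono huA.1 huB.1)
  · intro A _
    exact (integrableOn_prod_coord hX'c (Sum.elim I J)).mono_set
      fun u hu i => Set.Ioo_subset_Icc_self (hu.2 i)
end

section
/- (Witt dimension formula.) Let d ≥ 1 and n ≥ 1 be integers, and let L be the free Lie algebra over ℚ on d generators e₁, …, e_d. Let Lₙ be the degree-n homogeneous component of L, defined recursively as the ℚ-submodule with L₁ equal to the span of the generators and Lₙ equal to the span of all brackets [e_i, y] with i ∈ {1, …, d} and y ∈ L_{n−1}. Then Lₙ is finite dimensional and dim_ℚ Lₙ = (1/n) · Σ_{k ∣ n} μ(k) · d^{n/k}, where μ is the Möbius function and the sum is over positive divisors k of n. -/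
/-- The degree-`n` homogeneous component `Lₙ` of the free Lie algebra over `ℚ`
on `d` generators: `L₁` is the span of the generators, and `Lₙ` is the span of
all brackets `⁅e_i, y⁆` with `y ∈ L_{n-1}`. -/
noncomputable def freeLieComponent (d : ℕ) : ℕ → Submodule ℚ (FreeLieAlgebra ℚ (Fin d))
  | 0 => ⊥
  | 1 => Submodule.span ℚ (Set.range (FreeLieAlgebra.of ℚ))
  | n + 2 => Submodule.span ℚ
      {z | ∃ (i : Fin d) (y : FreeLieAlgebra ℚ (Fin d)),
        y ∈ freeLieComponent d (n + 1) ∧ z = ⁅FreeLieAlgebra.of ℚ i, y⁆}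

section Helpers

open Module

theorem finrank_eq_finrank_inf_ker {K V : Type*} [Field K] [AddCommGroup V] [Module K V]
    (T L : Submodule K V) [FiniteDimensional K T] (S E : V →ₗ[K] V)
    (hE : T.map E = T) (hLT : L ≤ T) (hSE : ∀ x ∈ L, S (E x) = 0)
    (hT : T ≤ L ⊔ T.map S) :
    finrank K L = finrank K (T ⊓ LinearMap.ker S : Submodule K V) := by
  have hEmaps : ∀ x ∈ T, E x ∈ T := fun x hx => hE ▸ Submodule.mem_map_of_mem hx
  have hEsurj : Function.Surjective (E.restrict hEmaps) := by
    rintro ⟨y, hy⟩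
    rw [← hE] at hy
    obtain ⟨x, hx, rfl⟩ := hy
    exact ⟨⟨x, hx⟩, rfl⟩
  have hEinj := LinearMap.injective_iff_surjective.2 hEsurj
  have : FiniteDimensional K L := Submodule.finiteDimensional_of_le hLT
  have : FiniteDimensional K (T ⊓ LinearMap.ker S : Submodule K V) :=
    Submodule.finiteDimensional_of_le inf_le_left
  have : FiniteDimensional K (T.map S) := inferInstance
  apply le_antisymm
  · let f : L →ₗ[K] (T ⊓ LinearMap.ker S : Submodule K V) :=
      E.restrict (fun x hx => ⟨hEmaps x (hLT hx), hSE x hx⟩)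
    apply LinearMap.finrank_le_finrank_of_injective (f := f)
    intro x y hxy
    have hE : E x = E y := Subtype.ext_iff.1 hxy
    have h : (⟨x, hLT x.2⟩ : T) = ⟨y, hLT y.2⟩ := hEinj (Subtype.ext hE)
    exact Subtype.ext (congrArg (fun z : T => (z : V)) h)
  · have h1 : finrank K T ≤ finrank K L + finrank K (T.map S) :=
      (Submodule.finrank_mono hT).trans (Submodule.finrank_add_le_finrank_add_finrank _ _)
    have h2 := (S.domRestrict T).finrank_range_add_finrank_ker
    rw [LinearMap.range_domRestrict, LinearMap.ker_domRestrict] at h2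
    have h3 : finrank K ((LinearMap.ker S).submoduleOf T)
        = finrank K (T ⊓ LinearMap.ker S : Submodule K V) := by
      rw [← Submodule.finrank_map_subtype_eq, Submodule.submoduleOf, Submodule.map_comap_subtype]
    rw [Submodule.submoduleOf] at h3
    omega

theorem finrank_span_algebraMap_comp {F K ι ι' : Type*} [Field F] [Field K] [Algebra F K]
    [Finite ι'] (v : ι → ι' → F) :
    finrank K (Submodule.span K (Set.range fun i => algebraMap F K ∘ v i))
      = finrank F (Submodule.span F (Set.range v)) := by
  apply le_antisymm
  · obtain ⟨f, hf, -, hli⟩ := Submodule.exists_fun_fin_finrank_span_eq K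
      (Set.range fun i => algebraMap F K ∘ v i)
    choose g hg using hf
    simp only [← funext hg] at hli
    rw [linearIndependent_algebraMap_comp_iff (v := fun j => v (g j))] at hli
    have := finrank_span_eq_card hli
    rw [Fintype.card_fin] at this
    rw [← this]
    exact Submodule.finrank_mono (Submodule.span_mono (by rintro _ ⟨j, rfl⟩; exact ⟨g j, rfl⟩))
  · obtain ⟨f, hf, -, hli⟩ := Submodule.exists_fun_fin_finrank_span_eq F (Set.range v)
    choose g hg using hf
    rw [← funext hg, ← linearIndependent_algebraMap_comp_iff (S := K)] at hli
    have := finrank_span_eq_card hli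
    rw [Fintype.card_fin] at this
    rw [← this]
    exact Submodule.finrank_mono (Submodule.span_mono (by rintro _ ⟨j, rfl⟩; exact ⟨g j, rfl⟩))

/-- Functions on `W` which are multiplied by `q` under the permutation `σ`. -/
def twistedInvariants {K W : Type*} [Field K] (σ : Equiv.Perm W) (q : K) :
    Submodule K (W → K) where
  carrier := {f | ∀ w, f (σ w) = q * f w}
  add_mem' hf hg w := by simp [hf w, hg w, mul_add]
  zero_mem' w := by simp
  smul_mem' c f hf w := by simp [hf w]; ring

theorem card_mul_finrank_twistedInvariants {K W : Type*} [Field K] [CharZero K] [Fintype W]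
    [DecidableEq W] (σ : Equiv.Perm W) (q : K) {n : ℕ} (hn : n ≠ 0) (hq : q ^ n = 1)
    (hσ : σ ^ n = 1) :
    (n : K) * finrank K (twistedInvariants σ q)
      = ∑ i ∈ Finset.range n, q⁻¹ ^ i * (Fintype.card {w // (σ ^ i) w = w} : K) := by
  have hq0 : q ≠ 0 := by rintro rfl; simp [hn] at hq
  have hnK : (n : K) ≠ 0 := by exact_mod_cast hn
  let p : (W → K) →ₗ[K] (W → K) :=
    (n : K)⁻¹ • ∑ i ∈ Finset.range n, q⁻¹ ^ i • LinearMap.funLeft K K (σ ^ i : Equiv.Perm W)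
  have hp_apply : ∀ f w, p f w = (n : K)⁻¹ * ∑ i ∈ Finset.range n, q⁻¹ ^ i * f ((σ ^ i) w) := by
    intro f w
    simp [p, LinearMap.funLeft_apply]
  have hp : LinearMap.IsProj (twistedInvariants σ q) p := by
    constructor
    · intro f w
      rw [hp_apply, hp_apply, mul_left_comm]
      congr 1
      have key : ∀ i, q⁻¹ ^ i * f ((σ ^ i) (σ w)) = q * (q⁻¹ ^ (i + 1) * f ((σ ^ (i + 1)) w)) := by
        intro i
        rw [pow_succ σ, Equiv.Perm.mul_apply, pow_succ]
        field_simp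
      rw [Finset.sum_congr rfl (fun i _ => key i), ← Finset.mul_sum,
        Finset.sum_range_succ' (fun i => q⁻¹ ^ i * f ((σ ^ i) w)) n |>.symm.trans
          (Finset.sum_range_succ (fun i => q⁻¹ ^ i * f ((σ ^ i) w)) n) |> eq_sub_of_add_eq]
      simp [hσ, hq]
    · intro f hf
      have hpow : ∀ i w, f ((σ ^ i) w) = q ^ i * f w := by
        intro i
        induction i with
        | zero => simp
        | succ i ih => intro w; rw [pow_succ, Equiv.Perm.mul_apply, ih, hf w]; ring
      ext w
      rw [hp_apply]
      simp only [hpow, ← mul_assoc, ← mul_pow, inv_mul_cancel₀ hq0]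
      simp [hnK]
  have htr := hp.trace
  rw [← htr, LinearMap.trace_eq_matrix_trace K (Pi.basisFun K W), Matrix.trace]
  simp only [Matrix.diag_apply, LinearMap.toMatrix_apply, Pi.basisFun_repr, Pi.basisFun_apply,
    hp_apply, ← Finset.mul_sum, mul_inv_cancel_left₀ hnK]
  rw [Finset.sum_comm]
  refine Finset.sum_congr rfl fun i _ => ?_
  rw [← Finset.mul_sum, Fintype.card_subtype]
  simp [Pi.single_apply]

theorem card_zmod_translation_invariant {α : Type*} [Fintype α] [DecidableEq α] (n i : ℕ)
    [NeZero n] :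
    Fintype.card {g : ZMod n → α // (fun j => g (j + i)) = g} = Fintype.card α ^ n.gcd i := by
  let H := AddSubgroup.zmultiples (i : ZMod n)
  have hinv : ∀ g : ZMod n → α, (fun j => g (j + i)) = g →
      ∀ (k : ℤ) j, g (j + k • (i : ZMod n)) = g j := by
    intro g hg k
    induction k using Int.induction_on with
    | zero => simp
    | succ k ih => intro j; rw [add_smul, ← add_assoc, one_smul, ← ih j]; exact congrFun hg _
    | pred k ih =>
      intro j
      rw [← ih j, ← congrFun hg (j + _)]
      congr 1
      rw [sub_smul, one_smul]; ring
  let e : {g : ZMod n → α // (fun j => g (j + i)) = g} ≃ (ZMod n ⧸ H → α) :=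
    { toFun g := fun x => Quotient.liftOn' x g.1 (by
        intro a b hab
        rw [QuotientAddGroup.leftRel_apply] at hab
        obtain ⟨k, hk⟩ := hab
        have := hinv g.1 g.2 k a
        simp only at hk
        rw [hk] at this
        simpa using this.symm)
      invFun f := ⟨fun j => f (QuotientAddGroup.mk j), by
        funext j
        refine congrArg f ?_
        rw [QuotientAddGroup.eq]
        exact ⟨-1, by simp⟩⟩
      left_inv g := rfl
      right_inv f := by
        funext x
        induction x using QuotientAddGroup.induction_on
        rfl }
  classical
  rw [Fintype.card_congr e, Fintype.card_fun]
  congr 1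
  have h1 := AddSubgroup.card_eq_card_quotient_mul_card_addSubgroup H
  rw [Nat.card_zmultiples, ZMod.addOrderOf_coe _ (NeZero.ne n), Nat.card_zmod,
    Nat.card_eq_fintype_card] at h1
  have hg : n.gcd i ∣ n := Nat.gcd_dvd_left n i
  have hpos : 0 < n / n.gcd i := Nat.div_pos (Nat.le_of_dvd (NeZero.pos n) hg)
    (Nat.gcd_pos_of_pos_left _ (NeZero.pos n))
  apply Nat.eq_of_mul_eq_mul_right hpos
  rw [← h1, Nat.mul_div_cancel' hg]

theorem IsPrimitiveRoot.sum_inv_pow_mul_gcd {K : Type*} [Field K] {q : K} {n : ℕ} (hn : 0 < n)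
    (hq : IsPrimitiveRoot q n) (f : ℕ → K) :
    ∑ i ∈ Finset.range n, q⁻¹ ^ i * f (n.gcd i)
      = ∑ k ∈ n.divisors, ((ArithmeticFunction.moebius k : ℤ) : K) * f (n / k) := by
  let a : ℕ → K := fun m => ∑ x ∈ m.divisorsAntidiagonal,
    ((ArithmeticFunction.moebius x.1 : ℤ) : K) * f x.2
  have ha : ∀ m > 0, ∑ i ∈ m.divisors, a i = f m :=
    ArithmeticFunction.sum_eq_iff_sum_mul_moebius_eq.2 fun m _ => rfl
  rw [← Nat.sum_divisorsAntidiagonal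
    (fun k l => ((ArithmeticFunction.moebius k : ℤ) : K) * f l)]
  change _ = a n
  have hgcd : ∀ i, f (n.gcd i) = ∑ m ∈ n.divisors, if m ∣ i then a m else 0 := by
    intro i
    rw [← ha _ (Nat.gcd_pos_of_pos_left i hn), ← Finset.sum_filter]
    refine Finset.sum_congr ?_ fun _ _ => rfl
    ext m
    simp [Nat.dvd_gcd_iff, hn.ne']
  simp only [hgcd, Finset.mul_sum]
  rw [Finset.sum_comm, Finset.sum_eq_single n]
  · rw [Finset.sum_eq_single 0]
    · simp
    · intro i hi hi0
      rw [if_neg, mul_zero]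
      exact fun h => hi0 (Nat.eq_zero_of_dvd_of_lt h (Finset.mem_range.1 hi))
    · simp [hn.ne']
  · intro m hm hmn
    obtain ⟨c, rfl⟩ := Nat.dvd_of_mem_divisors hm
    have hm0 : 0 < m := Nat.pos_of_mul_pos_right hn
    have hc1 : 1 < c := by
      rcases c with _ | _ | c
      · simp at hn
      · simp at hmn
      · omega
    have hprim : IsPrimitiveRoot (q⁻¹ ^ m) c := hq.inv.pow hn rfl
    have : ∑ i ∈ Finset.range (m * c), q⁻¹ ^ i * (if m ∣ i then a m else 0)
        = ∑ j ∈ Finset.range c, (q⁻¹ ^ m) ^ j * a m := by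
      simp only [mul_ite, mul_zero]
      rw [← Finset.sum_filter]
      symm
      refine Finset.sum_nbij (fun j => m * j) ?_ ?_ ?_ ?_
      · intro j hj
        simp only [Finset.mem_filter, Finset.mem_range] at hj ⊢
        exact ⟨Nat.mul_lt_mul_of_pos_left hj hm0, dvd_mul_right _ _⟩
      · intro j _ k _ h
        exact Nat.eq_of_mul_eq_mul_left hm0 h
      · intro i hi
        obtain ⟨hlt, j, rfl⟩ := Finset.mem_filter.1 (Finset.mem_coe.1 hi)
        exact ⟨j, by simpa [hm0] using hlt, rfl⟩
      · intro j _
        simp only [pow_mul]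
    rw [this, ← Finset.sum_mul, hprim.geom_sum_eq_zero hc1, zero_mul]
  · simp [hn.ne']

attribute [local instance] LieRing.ofAssociativeRing

/-- The left-normed iterated bracket `⁅…⁅⁅t, a x₁⁆, a x₂⁆, …, a xₖ⁆`. -/
def leftBracketFrom {α L : Type*} [LieRing L] (a : α → L) (t : L) (u : List α) : L :=
  u.foldl (fun s y => ⁅s, a y⁆) t

/-- The left-normed bracket `⁅…⁅a x₁, a x₂⁆, …, a xₖ⁆` of a nonempty word. -/
def leftBracket {α L : Type*} [LieRing L] (a : α → L) : List α → L
  | [] => 0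
  | x :: u => leftBracketFrom a (a x) u

theorem leftBracketFrom_append_singleton {α L : Type*} [LieRing L] (a : α → L) (t : L)
    (u : List α) (y : α) :
    leftBracketFrom a t (u ++ [y]) = ⁅leftBracketFrom a t u, a y⁆ := by
  simp [leftBracketFrom]

theorem map_leftBracket {α L L' : Type*} [LieRing L] [LieRing L'] (a : α → L) (f : L → L')
    (h0 : f 0 = 0) (hf : ∀ x y, f ⁅x, y⁆ = ⁅f x, f y⁆) (w : List α) :
    f (leftBracket a w) = leftBracket (f ∘ a) w := by
  have key : ∀ (u : List α) (t : L),
      f (leftBracketFrom a t u) = leftBracketFrom (f ∘ a) (f t) u := by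
    intro u
    induction u with
    | nil => intro t; rfl
    | cons y u ih => intro t; simpa [leftBracketFrom, hf] using ih ⁅t, a y⁆
  cases w with
  | nil => exact h0
  | cons x u => exact key u (a x)

namespace WordAlgebra

variable (K α : Type*) [Field K]

/-- The letter `x` as an element of the algebra of noncommutative polynomials. -/
noncomputable def letter {α : Type*} (x : α) : MonoidAlgebra K (FreeMonoid α) :=
  MonoidAlgebra.single (FreeMonoid.of x) 1

/-- The noncommutative polynomials that are homogeneous of degree `n`. -/
noncomputable def degreePart (n : ℕ) : Submodule K (MonoidAlgebra K (FreeMonoid α)) :=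
  Submodule.span K ((fun w => MonoidAlgebra.single w 1) '' {w : FreeMonoid α | w.length = n})

variable {K α}

theorem single_mem_degreePart (w : FreeMonoid α) :
    MonoidAlgebra.single w 1 ∈ degreePart K α w.length :=
  Submodule.subset_span ⟨w, rfl, rfl⟩

theorem degreePart_le {n : ℕ} {P : Submodule K (MonoidAlgebra K (FreeMonoid α))}
    (h : ∀ w : FreeMonoid α, w.length = n → MonoidAlgebra.single w 1 ∈ P) :
    degreePart K α n ≤ P := by
  rw [degreePart, Submodule.span_le]
  rintro _ ⟨w, hw, rfl⟩
  exact h w hw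

theorem one_mem_degreePart : 1 ∈ degreePart K α 0 := single_mem_degreePart 1

theorem letter_mem_degreePart (x : α) : letter K x ∈ degreePart K α 1 :=
  single_mem_degreePart (FreeMonoid.of x)

theorem letter_mul_single (x : α) (w : FreeMonoid α) :
    letter K x * MonoidAlgebra.single w 1 = MonoidAlgebra.single (FreeMonoid.of x * w) 1 := by
  simp [letter, MonoidAlgebra.single_mul_single]

theorem mul_mem_degreePart {m n : ℕ} {s t : MonoidAlgebra K (FreeMonoid α)}
    (hs : s ∈ degreePart K α m) (ht : t ∈ degreePart K α n) :
    s * t ∈ degreePart K α (m + n) := by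
  have h := Submodule.mul_mem_mul hs ht
  rw [degreePart, degreePart, Submodule.span_mul_span] at h
  refine Submodule.span_mono ?_ h
  rintro _ ⟨_, ⟨v, rfl, rfl⟩, _, ⟨w, rfl, rfl⟩, rfl⟩
  exact ⟨v * w, FreeMonoid.length_mul v w, by simp [MonoidAlgebra.single_mul_single]⟩

theorem degreePart_succ_le {n : ℕ} {P : Submodule K (MonoidAlgebra K (FreeMonoid α))}
    (h : ∀ x, ∀ t ∈ degreePart K α n, letter K x * t ∈ P) :
    degreePart K α (n + 1) ≤ P := by
  refine degreePart_le fun w hw => ?_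
  induction w using FreeMonoid.casesOn with
  | one => simp at hw
  | of_mul x u =>
    rw [← letter_mul_single]
    have hu : u.length = n := by
      rw [FreeMonoid.length_mul, FreeMonoid.length_of] at hw
      omega
    exact h x _ (hu ▸ single_mem_degreePart u)

variable (K α) in
/-- The linear map rotating each word by moving its first letter to the end. -/
noncomputable def rotation :
    MonoidAlgebra K (FreeMonoid α) →ₗ[K] MonoidAlgebra K (FreeMonoid α) :=
  MonoidAlgebra.mapDomainLinearMap K K fun w => FreeMonoid.ofList (w.toList.rotate 1)

theorem rotation_single (w : FreeMonoid α) :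
    rotation K α (MonoidAlgebra.single w 1)
      = MonoidAlgebra.single (FreeMonoid.ofList (w.toList.rotate 1)) 1 := by
  simp [rotation]

theorem rotation_letter_mul (x : α) (t : MonoidAlgebra K (FreeMonoid α)) :
    rotation K α (letter K x * t) = t * letter K x := by
  have : rotation K α ∘ₗ LinearMap.mulLeft K (letter K x) = LinearMap.mulRight K (letter K x) := by
    refine (MonoidAlgebra.basis (FreeMonoid α) K).ext fun w => ?_
    simp [letter, MonoidAlgebra.single_mul_single, rotation, FreeMonoid.ofList_append]
  exact LinearMap.congr_fun this t

theorem rotation_mem_degreePart {n : ℕ} {t : MonoidAlgebra K (FreeMonoid α)}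
    (ht : t ∈ degreePart K α n) : rotation K α t ∈ degreePart K α n := by
  refine degreePart_le (P := (degreePart K α n).comap (rotation K α)) (fun w hw => ?_) ht
  rw [Submodule.mem_comap, rotation_single, ← hw]
  convert single_mem_degreePart (K := K) (FreeMonoid.ofList (w.toList.rotate 1)) using 2
  simp [FreeMonoid.length]

theorem rotation_pow_single (k : ℕ) (w : FreeMonoid α) :
    (rotation K α ^ k) (MonoidAlgebra.single w 1)
      = MonoidAlgebra.single (FreeMonoid.ofList (w.toList.rotate k)) 1 := by
  induction k with
  | zero => simp
  | succ k ih =>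
    rw [pow_succ', Module.End.mul_apply, ih, rotation_single, FreeMonoid.toList_ofList,
      List.rotate_rotate]

theorem rotation_pow_apply {n : ℕ} {t : MonoidAlgebra K (FreeMonoid α)}
    (ht : t ∈ degreePart K α n) : (rotation K α ^ n) t = t := by
  refine degreePart_le (P := LinearMap.eqLocus (rotation K α ^ n) LinearMap.id)
    (fun w hw => ?_) ht
  rw [LinearMap.mem_eqLocus, rotation_pow_single]
  have : w.toList.rotate n = w.toList := by rw [← hw]; exact List.rotate_length _
  simp [this]

variable (α) in
/-- The operator `t ↦ t - q • rotation t`. -/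
noncomputable def twist (q : K) :
    MonoidAlgebra K (FreeMonoid α) →ₗ[K] MonoidAlgebra K (FreeMonoid α) :=
  1 - q • rotation K α

theorem twist_apply (q : K) (t : MonoidAlgebra K (FreeMonoid α)) :
    twist α q t = t - q • rotation K α t := rfl

theorem twist_mem_degreePart (q : K) {n : ℕ} {t : MonoidAlgebra K (FreeMonoid α)}
    (ht : t ∈ degreePart K α n) : twist α q t ∈ degreePart K α n :=
  sub_mem ht (Submodule.smul_mem _ _ (rotation_mem_degreePart ht))

theorem degreePart_le_map_twist {q : K} {n : ℕ} (hq : q ^ n ≠ 1) :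
    degreePart K α n ≤ (degreePart K α n).map (twist α q) := by
  intro t ht
  have hpow : ∀ i, (rotation K α ^ i) t ∈ degreePart K α n := by
    intro i
    induction i with
    | zero => exact ht
    | succ i ih => rw [pow_succ', Module.End.mul_apply]; exact rotation_mem_degreePart ih
  have hq' : 1 - q ^ n ≠ 0 := sub_ne_zero.2 hq.symm
  refine ⟨(1 - q ^ n)⁻¹ • ∑ i ∈ Finset.range n, ((q • rotation K α) ^ i) t,
    Submodule.smul_mem _ _ (Submodule.sum_mem _ fun i _ => ?_), ?_⟩
  · rw [smul_pow]
    exact Submodule.smul_mem _ _ (hpow i)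
  · have h := LinearMap.congr_fun (mul_neg_geom_sum (q • rotation K α) n) t
    rw [Module.End.mul_apply, LinearMap.sum_apply] at h
    rw [map_smul]
    change _ • (1 - q • rotation K α) _ = _
    rw [h, smul_pow, LinearMap.sub_apply, LinearMap.smul_apply, rotation_pow_apply ht,
      Module.End.one_apply, inv_smul_eq_iff₀ hq', sub_smul, one_smul]

variable (α) in
/-- The action of the word algebra on itself in which the letter `x` acts as the
`q`-commutator `t ↦ x * t - q • (t * x)`. -/
noncomputable def qAction (q : K) :
    MonoidAlgebra K (FreeMonoid α) →ₐ[K] Module.End K (MonoidAlgebra K (FreeMonoid α)) :=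
  MonoidAlgebra.lift K _ (FreeMonoid α) (FreeMonoid.lift fun x =>
    LinearMap.mulLeft K (letter K x) - q • LinearMap.mulRight K (letter K x))

theorem qAction_letter (q : K) (x : α) :
    qAction α q (letter K x)
      = LinearMap.mulLeft K (letter K x) - q • LinearMap.mulRight K (letter K x) := by
  simp [qAction, letter]

variable (α) in
/-- The linear map sending a word `x₁ ⋯ xₙ` to the iterated `q`-commutator
`[x₁, [x₂, … [xₙ, 1]_q … ]_q]_q`. -/
noncomputable def qBracket (q : K) :
    MonoidAlgebra K (FreeMonoid α) →ₗ[K] MonoidAlgebra K (FreeMonoid α) :=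
  LinearMap.applyₗ 1 ∘ₗ (qAction α q).toLinearMap

theorem qBracket_one (q : K) : qBracket α q 1 = 1 := by
  simp [qBracket]

theorem qBracket_letter_mul (q : K) (x : α) (t : MonoidAlgebra K (FreeMonoid α)) :
    qBracket α q (letter K x * t)
      = letter K x * qBracket α q t - q • (qBracket α q t * letter K x) := by
  simp [qBracket, qAction_letter]

theorem qBracket_mem_degreePart (q : K) {n : ℕ} {t : MonoidAlgebra K (FreeMonoid α)}
    (ht : t ∈ degreePart K α n) : qBracket α q t ∈ degreePart K α n := by
  induction n generalizing t with
  | zero =>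
    refine degreePart_le (P := (degreePart K α 0).comap (qBracket α q)) (fun w hw => ?_) ht
    rw [FreeMonoid.length_eq_zero] at hw
    rw [hw, Submodule.mem_comap, ← MonoidAlgebra.one_def, qBracket_one]
    exact one_mem_degreePart
  | succ n ih =>
    refine degreePart_succ_le (P := (degreePart K α (n + 1)).comap (qBracket α q))
      (fun x t ht => ?_) ht
    rw [Submodule.mem_comap, qBracket_letter_mul]
    refine sub_mem ?_ (Submodule.smul_mem _ _ (mul_mem_degreePart (ih ht) (letter_mem_degreePart x)))
    rw [add_comm]
    exact mul_mem_degreePart (letter_mem_degreePart x) (ih ht)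

variable (α) in
/-- The linear map applying the iterated `q`-commutator to all letters of a word but the first. -/
noncomputable def tailBracket (q : K) :
    MonoidAlgebra K (FreeMonoid α) →ₗ[K] MonoidAlgebra K (FreeMonoid α) :=
  (MonoidAlgebra.basis (FreeMonoid α) K).constr K fun w =>
    FreeMonoid.casesOn w 0 fun x u => letter K x * qBracket α q (MonoidAlgebra.single u 1)

theorem tailBracket_letter_mul (q : K) (x : α) (t : MonoidAlgebra K (FreeMonoid α)) :
    tailBracket α q (letter K x * t) = letter K x * qBracket α q t := by
  have : tailBracket α q ∘ₗ LinearMap.mulLeft K (letter K x)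
      = LinearMap.mulLeft K (letter K x) ∘ₗ qBracket α q := by
    refine (MonoidAlgebra.basis (FreeMonoid α) K).ext fun w => ?_
    rw [LinearMap.comp_apply, LinearMap.comp_apply, MonoidAlgebra.basis_apply,
      LinearMap.mulLeft_apply, LinearMap.mulLeft_apply, letter_mul_single, tailBracket,
      ← MonoidAlgebra.basis_apply, Basis.constr_basis, FreeMonoid.casesOn_of_mul]
  exact LinearMap.congr_fun this t

theorem tailBracket_mem_degreePart (q : K) {n : ℕ} {t : MonoidAlgebra K (FreeMonoid α)}
    (ht : t ∈ degreePart K α (n + 1)) : tailBracket α q t ∈ degreePart K α (n + 1) := by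
  refine degreePart_succ_le (P := (degreePart K α (n + 1)).comap (tailBracket α q))
    (fun x t ht => ?_) ht
  rw [Submodule.mem_comap, tailBracket_letter_mul, add_comm]
  exact mul_mem_degreePart (letter_mem_degreePart x) (qBracket_mem_degreePart q ht)

theorem twist_tailBracket (q : K) {n : ℕ} {t : MonoidAlgebra K (FreeMonoid α)}
    (ht : t ∈ degreePart K α (n + 1)) : twist α q (tailBracket α q t) = qBracket α q t := by
  refine degreePart_succ_le
    (P := LinearMap.eqLocus (twist α q ∘ₗ tailBracket α q) (qBracket α q)) (fun x t ht => ?_) ht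
  rw [LinearMap.mem_eqLocus, LinearMap.comp_apply, tailBracket_letter_mul, qBracket_letter_mul,
    twist_apply, rotation_letter_mul]

theorem degreePart_le_map_tailBracket {q : K} {n : ℕ}
    (h : degreePart K α n ≤ (degreePart K α n).map (qBracket α q)) :
    degreePart K α (n + 1) ≤ (degreePart K α (n + 1)).map (tailBracket α q) := by
  refine degreePart_succ_le fun x t ht => ?_
  obtain ⟨s, hs, rfl⟩ := h ht
  refine ⟨letter K x * s, ?_, tailBracket_letter_mul q x s⟩
  rw [add_comm]
  exact mul_mem_degreePart (letter_mem_degreePart x) hs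

theorem degreePart_le_map_qBracket {q : K} {n : ℕ} (hq : ∀ k, 1 ≤ k → k ≤ n → q ^ k ≠ 1) :
    degreePart K α n ≤ (degreePart K α n).map (qBracket α q) := by
  induction n with
  | zero =>
    refine degreePart_le fun w hw => ?_
    rw [FreeMonoid.length_eq_zero] at hw
    rw [hw, ← MonoidAlgebra.one_def]
    exact ⟨1, one_mem_degreePart, qBracket_one q⟩
  | succ n ih =>
    intro t ht
    obtain ⟨s, hs, rfl⟩ := degreePart_le_map_twist (hq (n + 1) (by omega) le_rfl) ht
    obtain ⟨r, hr, rfl⟩ := degreePart_le_map_tailBracket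
      (ih fun k h1 h2 => hq k h1 (by omega)) hs
    exact ⟨r, hr, (twist_tailBracket q hr).symm⟩

theorem qAction_leftBracketFrom (q : K) (u : List α) {t : MonoidAlgebra K (FreeMonoid α)} {k : ℕ}
    (ht : qAction α q t = LinearMap.mulLeft K t - q ^ k • LinearMap.mulRight K t) :
    qAction α q (leftBracketFrom (letter K) t u)
      = LinearMap.mulLeft K (leftBracketFrom (letter K) t u)
        - q ^ (k + u.length) • LinearMap.mulRight K (leftBracketFrom (letter K) t u) := by
  induction u generalizing t k with
  | nil => exact ht
  | cons y u ih =>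
    have : qAction α q ⁅t, letter K y⁆ = LinearMap.mulLeft K ⁅t, letter K y⁆
        - q ^ (k + 1) • LinearMap.mulRight K ⁅t, letter K y⁆ := by
      rw [LieRing.of_associative_ring_bracket, map_sub, map_mul, map_mul, ht, qAction_letter]
      refine LinearMap.ext fun s => ?_
      simp only [LinearMap.sub_apply, LinearMap.smul_apply, Module.End.mul_apply,
        LinearMap.mulLeft_apply, LinearMap.mulRight_apply, mul_sub, sub_mul, smul_sub,
        mul_smul_comm, smul_mul_assoc, smul_smul, mul_assoc, pow_succ, mul_comm q]
      abel
    have h := ih this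
    rw [List.length_cons, ← Nat.add_assoc, Nat.add_right_comm]
    exact h

theorem twist_tailBracket_leftBracket {q : K} {n : ℕ} (hq : q ^ (n + 1) = 1) (w : List α)
    (hw : w.length = n + 1) (hmem : leftBracket (letter K) w ∈ degreePart K α (n + 1)) :
    twist α q (tailBracket α q (leftBracket (letter K) w)) = 0 := by
  rw [twist_tailBracket q hmem]
  cases w with
  | nil => simp at hw
  | cons x u =>
    have h := qAction_leftBracketFrom q u (t := letter K x) (k := 1)
      (by rw [pow_one, qAction_letter])
    rw [add_comm, ← List.length_cons (a := x), hw, hq, one_smul] at h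
    change qAction α q (leftBracketFrom (letter K) (letter K x) u) 1 = 0
    rw [h]
    simp

theorem leftBracketFrom_mem_degreePart (u : List α) {t : MonoidAlgebra K (FreeMonoid α)} {k : ℕ}
    (ht : t ∈ degreePart K α k) :
    leftBracketFrom (letter K) t u ∈ degreePart K α (k + u.length) := by
  induction u generalizing t k with
  | nil => exact ht
  | cons y u ih =>
    have : ⁅t, letter K y⁆ ∈ degreePart K α (k + 1) := by
      rw [LieRing.of_associative_ring_bracket]
      refine sub_mem (mul_mem_degreePart ht (letter_mem_degreePart y)) ?_
      rw [add_comm]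
      exact mul_mem_degreePart (letter_mem_degreePart y) ht
    have h := ih this
    rw [List.length_cons, ← Nat.add_assoc, Nat.add_right_comm]
    exact h

theorem leftBracket_mem_degreePart (w : List α) :
    leftBracket (letter K) w ∈ degreePart K α w.length := by
  cases w with
  | nil => exact zero_mem _
  | cons x u =>
    rw [List.length_cons, add_comm]
    exact leftBracketFrom_mem_degreePart u (letter_mem_degreePart x)

theorem leftBracketFrom_sub_mem_map_twist (q : K) (u : List α)
    {t : MonoidAlgebra K (FreeMonoid α)} {k : ℕ} (ht : t ∈ degreePart K α k) :
    leftBracketFrom (letter K) t u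
        - t * qBracket α q (MonoidAlgebra.single (FreeMonoid.ofList u) 1)
      ∈ (degreePart K α (k + u.length)).map (twist α q) := by
  induction u generalizing t k with
  | nil =>
    rw [FreeMonoid.ofList_nil, ← MonoidAlgebra.one_def, qBracket_one, mul_one]
    simp [leftBracketFrom]
  | cons y u ih =>
    have h1 : t * letter K y ∈ degreePart K α (k + 1) :=
      mul_mem_degreePart ht (letter_mem_degreePart y)
    have h2 : letter K y * t ∈ degreePart K α (k + 1) := by
      rw [add_comm]
      exact mul_mem_degreePart (letter_mem_degreePart y) ht
    have hb : ⁅t, letter K y⁆ ∈ degreePart K α (k + 1) := sub_mem h1 h2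
    have h := ih hb
    set b := qBracket α q (MonoidAlgebra.single (FreeMonoid.ofList u) 1) with hbdef
    have hbmem : b ∈ degreePart K α u.length :=
      qBracket_mem_degreePart q (single_mem_degreePart (FreeMonoid.ofList u))
    have htw : twist α q (letter K y * t * b) ∈
        (degreePart K α (k + 1 + u.length)).map (twist α q) :=
      Submodule.mem_map_of_mem (mul_mem_degreePart h2 hbmem)
    rw [FreeMonoid.ofList_cons, ← letter_mul_single, qBracket_letter_mul, ← hbdef,
      List.length_cons, ← Nat.add_assoc, Nat.add_right_comm]
    convert sub_mem h htw using 1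
    rw [twist_apply, mul_assoc, rotation_letter_mul, LieRing.of_associative_ring_bracket]
    change leftBracketFrom (letter K) ⁅t, letter K y⁆ u - _ = _
    rw [LieRing.of_associative_ring_bracket]
    simp only [mul_sub, sub_mul, mul_smul_comm, mul_assoc]
    abel

theorem leftBracket_sub_mem_map_twist (q : K) (w : FreeMonoid α) (hw : w ≠ 1) :
    leftBracket (letter K) w.toList - tailBracket α q (MonoidAlgebra.single w 1)
      ∈ (degreePart K α w.length).map (twist α q) := by
  induction w using FreeMonoid.casesOn with
  | one => exact absurd rfl hw
  | of_mul x u =>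
    rw [← letter_mul_single, tailBracket_letter_mul, FreeMonoid.length_mul]
    exact leftBracketFrom_sub_mem_map_twist q u.toList (letter_mem_degreePart x)

theorem coeff_rotation (t : MonoidAlgebra K (FreeMonoid α)) (w : FreeMonoid α) :
    (rotation K α t).coeff (FreeMonoid.ofList (w.toList.rotate 1)) = t.coeff w := by
  have hinj : Function.Injective fun w : FreeMonoid α => FreeMonoid.ofList (w.toList.rotate 1) :=
    fun v w h => FreeMonoid.toList.injective
      (List.rotate_injective 1 (FreeMonoid.ofList.injective h))
  exact Finsupp.mapDomain_apply hinj t.coeff w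

theorem coeff_eq_zero_of_mem_degreePart {n : ℕ} {t : MonoidAlgebra K (FreeMonoid α)}
    (ht : t ∈ degreePart K α n) {w : FreeMonoid α} (hw : w.length ≠ n) : t.coeff w = 0 := by
  rw [degreePart, ← MonoidAlgebra.supported_eq_span_single, MonoidAlgebra.mem_supported'] at ht
  exact ht w hw

theorem ofFn_rotate_one {n : ℕ} (g : Fin (n + 1) → α) :
    (List.ofFn g).rotate 1 = List.ofFn fun j => g (j + 1) := by
  refine List.ext_getElem (by simp) fun i h1 h2 => ?_
  rw [List.getElem_rotate, List.getElem_ofFn, List.getElem_ofFn]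
  refine congrArg g (Fin.ext ?_)
  simp [Fin.val_add]

/-- The word of length `n + 1` with prescribed letters, indexed cyclically. -/
def cyclicWord {n : ℕ} (g : ZMod (n + 1) → α) : FreeMonoid α :=
  FreeMonoid.ofList (List.ofFn (n := n + 1) g)

theorem length_cyclicWord {n : ℕ} (g : ZMod (n + 1) → α) : (cyclicWord g).length = n + 1 :=
  List.length_ofFn

theorem cyclicWord_injective {n : ℕ} :
    Function.Injective (cyclicWord : (ZMod (n + 1) → α) → FreeMonoid α) :=
  fun _ _ h => List.ofFn_injective (FreeMonoid.ofList.injective h)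

theorem exists_cyclicWord_eq {n : ℕ} {w : FreeMonoid α} (hw : w.length = n + 1) :
    ∃ g : ZMod (n + 1) → α, cyclicWord g = w := by
  change w.toList.length = n + 1 at hw
  refine ⟨fun i : Fin (n + 1) => w.toList.get (i.cast hw.symm), FreeMonoid.toList.injective ?_⟩
  change List.ofFn (n := n + 1) _ = _
  conv_rhs => rw [← List.ofFn_get w.toList, List.ofFn_congr hw]

variable (K α) in
/-- The coefficients of the words of length `n + 1`. -/
noncomputable def wordCoeff (n : ℕ) :
    MonoidAlgebra K (FreeMonoid α) →ₗ[K] ((ZMod (n + 1) → α) → K) where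
  toFun t g := t.coeff (cyclicWord g)
  map_add' _ _ := rfl
  map_smul' _ _ := rfl

theorem eq_zero_of_wordCoeff_eq_zero {n : ℕ} {t : MonoidAlgebra K (FreeMonoid α)}
    (ht : t ∈ degreePart K α (n + 1)) (h : wordCoeff K α n t = 0) : t = 0 := by
  refine MonoidAlgebra.ext (Finsupp.ext fun w => ?_)
  by_cases hw : w.length = n + 1
  · obtain ⟨g, rfl⟩ := exists_cyclicWord_eq hw
    exact congrFun h g
  · exact coeff_eq_zero_of_mem_degreePart ht hw

theorem finrank_map_wordCoeff {n : ℕ} {P : Submodule K (MonoidAlgebra K (FreeMonoid α))}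
    (hP : P ≤ degreePart K α (n + 1)) : finrank K (P.map (wordCoeff K α n)) = finrank K P := by
  rw [← LinearMap.range_domRestrict]
  refine LinearMap.finrank_range_of_inj ((injective_iff_map_eq_zero _).2 fun t ht => ?_)
  exact Subtype.ext (eq_zero_of_wordCoeff_eq_zero (hP t.2) ht)

instance finiteDimensional_degreePart [Finite α] (n : ℕ) :
    FiniteDimensional K (degreePart K α n) :=
  FiniteDimensional.span_of_finite K (Set.Finite.image _ (List.finite_length_eq α n))

variable (α) in
/-- The cyclic shift of the letters of a word. -/
def cyclicShift (n : ℕ) : Equiv.Perm (ZMod (n + 1) → α) :=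
  Equiv.arrowCongr (Equiv.subRight 1) (Equiv.refl α)

theorem cyclicShift_pow_apply {n : ℕ} (i : ℕ) (g : ZMod (n + 1) → α) :
    (cyclicShift α n ^ i) g = fun j => g (j + i) := by
  induction i with
  | zero => simp
  | succ i ih =>
    rw [pow_succ', Equiv.Perm.mul_apply, ih]
    funext j
    change g (j + 1 + i) = _
    push_cast
    ring_nf

theorem cyclicShift_pow_eq_one (n : ℕ) : cyclicShift α n ^ (n + 1) = 1 := by
  refine Equiv.ext fun g => ?_
  rw [cyclicShift_pow_apply]
  funext j
  rw [ZMod.natCast_self, add_zero]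
  rfl

theorem cyclicWord_cyclicShift {n : ℕ} (g : ZMod (n + 1) → α) :
    cyclicWord (cyclicShift α n g) = FreeMonoid.ofList ((cyclicWord g).toList.rotate 1) :=
  congrArg FreeMonoid.ofList (ofFn_rotate_one g).symm

theorem wordCoeff_twist_cyclicShift (q : K) {n : ℕ} (t : MonoidAlgebra K (FreeMonoid α))
    (g : ZMod (n + 1) → α) :
    wordCoeff K α n (twist α q t) (cyclicShift α n g)
      = wordCoeff K α n t (cyclicShift α n g) - q * wordCoeff K α n t g := by
  rw [twist_apply, map_sub, map_smul, Pi.sub_apply, Pi.smul_apply, smul_eq_mul]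
  congr 2
  change (rotation K α t).coeff _ = t.coeff _
  rw [cyclicWord_cyclicShift, coeff_rotation]

theorem map_wordCoeff_ker_twist [Finite α] (q : K) (n : ℕ) :
    (degreePart K α (n + 1) ⊓ LinearMap.ker (twist α q)).map (wordCoeff K α n)
      = twistedInvariants (cyclicShift α n) q := by
  refine le_antisymm ?_ fun f hf => ?_
  · rintro _ ⟨t, ⟨-, ht⟩, rfl⟩ g
    rw [← sub_eq_zero, ← wordCoeff_twist_cyclicShift, LinearMap.mem_ker.1 ht, map_zero]
    rfl
  · have := Fintype.ofFinite (ZMod (n + 1) → α)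
    let t : MonoidAlgebra K (FreeMonoid α) :=
      ∑ g, f g • MonoidAlgebra.single (cyclicWord g) 1
    have ht : t ∈ degreePart K α (n + 1) :=
      Submodule.sum_mem _ fun g _ => Submodule.smul_mem _ _
        (length_cyclicWord g ▸ single_mem_degreePart (cyclicWord g))
    have hcoeff : wordCoeff K α n t = f := by
      classical
      funext g
      have : ∀ h : ZMod (n + 1) → α,
          wordCoeff K α n (MonoidAlgebra.single (cyclicWord h) 1) g = if h = g then 1 else 0 := by
        intro h
        change (MonoidAlgebra.single (cyclicWord h) (1 : K)).coeff (cyclicWord g) = _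
        rw [MonoidAlgebra.coeff_single, Finsupp.single_apply]
        simp only [cyclicWord_injective.eq_iff]
      simp only [t, map_sum, map_smul, Finset.sum_apply, Pi.smul_apply, this]
      simp
    refine ⟨t, ⟨ht, ?_⟩, hcoeff⟩
    refine eq_zero_of_wordCoeff_eq_zero (twist_mem_degreePart q ht) (funext fun g => ?_)
    obtain ⟨g, rfl⟩ := (cyclicShift α n).surjective g
    rw [wordCoeff_twist_cyclicShift, hcoeff, hf g, sub_self]
    rfl

variable (K α) in
/-- The span of the left-normed brackets of `n` letters in the word algebra. -/
noncomputable def bracketSpan (n : ℕ) : Submodule K (MonoidAlgebra K (FreeMonoid α)) :=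
  Submodule.span K ((fun w : FreeMonoid α => leftBracket (letter K) w.toList) ''
    {w | w.length = n})

theorem bracketSpan_le_degreePart (n : ℕ) : bracketSpan K α n ≤ degreePart K α n := by
  rw [bracketSpan, Submodule.span_le]
  rintro _ ⟨w, rfl, rfl⟩
  exact leftBracket_mem_degreePart w.toList

theorem finrank_bracketSpan_eq_finrank_ker_twist [Finite α] {q : K} {n : ℕ}
    (hq : IsPrimitiveRoot q (n + 1)) :
    finrank K (bracketSpan K α (n + 1))
      = finrank K (degreePart K α (n + 1) ⊓ LinearMap.ker (twist α q) :
        Submodule K (MonoidAlgebra K (FreeMonoid α))) := by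
  have hle : degreePart K α (n + 1) ≤ (degreePart K α (n + 1)).map (tailBracket α q) :=
    degreePart_le_map_tailBracket (degreePart_le_map_qBracket fun k h1 h2 =>
      hq.pow_ne_one_of_pos_of_lt (by omega) (by omega))
  refine finrank_eq_finrank_inf_ker _ _ (twist α q) (tailBracket α q)
    (le_antisymm ?_ hle) (bracketSpan_le_degreePart _) (fun t ht => ?_) (hle.trans ?_)
  · rintro _ ⟨t, ht, rfl⟩
    exact tailBracket_mem_degreePart q ht
  · have : bracketSpan K α (n + 1) ≤ LinearMap.ker (twist α q ∘ₗ tailBracket α q) := by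
      rw [bracketSpan, Submodule.span_le]
      rintro _ ⟨w, hw, rfl⟩
      have hmem := leftBracket_mem_degreePart (K := K) w.toList
      exact twist_tailBracket_leftBracket hq.pow_eq_one _ hw (hw ▸ hmem)
    exact this ht
  · rw [Submodule.map_le_iff_le_comap]
    refine degreePart_le fun w hw => ?_
    have h := leftBracket_sub_mem_map_twist q w (by rintro rfl; simp at hw)
    rw [hw] at h
    rw [Submodule.mem_comap, ← sub_sub_cancel (leftBracket (letter K) w.toList)
      (tailBracket α q (MonoidAlgebra.single w 1))]
    exact sub_mem (Submodule.mem_sup_left (Submodule.subset_span ⟨w, hw, rfl⟩))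
      (Submodule.mem_sup_right h)

theorem card_mul_finrank_bracketSpan [CharZero K] [Fintype α] {q : K} {n : ℕ}
    (hq : IsPrimitiveRoot q (n + 1)) :
    ((n + 1 : ℕ) : K) * finrank K (bracketSpan K α (n + 1))
      = ∑ k ∈ (n + 1).divisors, ((ArithmeticFunction.moebius k : ℤ) : K)
        * (Fintype.card α : K) ^ ((n + 1) / k) := by
  classical
  rw [finrank_bracketSpan_eq_finrank_ker_twist hq, ← finrank_map_wordCoeff inf_le_left,
    map_wordCoeff_ker_twist, card_mul_finrank_twistedInvariants _ q n.succ_ne_zero hq.pow_eq_one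
      (cyclicShift_pow_eq_one n),
    ← hq.sum_inv_pow_mul_gcd n.succ_pos fun m => (Fintype.card α : K) ^ m]
  refine Finset.sum_congr rfl fun i _ => ?_
  simp only [cyclicShift_pow_apply]
  rw [card_zmod_translation_invariant, Nat.cast_pow]

theorem map_wordCoeff_bracketSpan (n : ℕ) :
    (bracketSpan K α (n + 1)).map (wordCoeff K α n)
      = Submodule.span K (Set.range fun w : {w : FreeMonoid α // w.length = n + 1} =>
        wordCoeff K α n (leftBracket (letter K) w.1.toList)) := by
  rw [bracketSpan, Submodule.map_span, Set.image_image, Set.image_eq_range]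
  rfl

theorem finrank_bracketSpan_algebra {F : Type*} [Field F] [Algebra F K] [Finite α] (n : ℕ) :
    finrank K (bracketSpan K α (n + 1)) = finrank F (bracketSpan F α (n + 1)) := by
  have hmap : ∀ w : FreeMonoid α, wordCoeff K α n (leftBracket (letter K) w.toList)
      = algebraMap F K ∘ wordCoeff F α n (leftBracket (letter F) w.toList) := by
    intro w
    let f := MonoidAlgebra.mapRingHom (FreeMonoid α) (algebraMap F K)
    have h := map_leftBracket (letter F) f (map_zero f) (fun x y => by
      simp [LieRing.of_associative_ring_bracket]) w.toList
    have hf : f ∘ letter F = letter K := by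
      funext x
      simp [f, letter]
    rw [hf] at h
    rw [← h]
    funext g
    exact MonoidAlgebra.coeff_mapRingHom _ _ _
  rw [← finrank_map_wordCoeff (bracketSpan_le_degreePart _),
    ← finrank_map_wordCoeff (bracketSpan_le_degreePart _), map_wordCoeff_bracketSpan,
    map_wordCoeff_bracketSpan]
  rw [funext fun w : {w : FreeMonoid α // w.length = n + 1} => hmap w.1]
  exact finrank_span_algebraMap_comp _

theorem finrank_bracketSpan_rat [Fintype α] {n : ℕ} (hn : 0 < n) :
    (n : ℚ) * finrank ℚ (bracketSpan ℚ α n)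
      = ∑ k ∈ n.divisors, ((ArithmeticFunction.moebius k : ℤ) : ℚ)
        * (Fintype.card α : ℚ) ^ (n / k) := by
  obtain ⟨n, rfl⟩ := Nat.exists_eq_succ_of_ne_zero hn.ne'
  have h := card_mul_finrank_bracketSpan (α := α) (Complex.isPrimitiveRoot_exp (n + 1) (by omega))
  rw [finrank_bracketSpan_algebra (F := ℚ)] at h
  exact_mod_cast h

end WordAlgebra

section FreeLie

variable {α : Type*}

open WordAlgebra

theorem freeLieComponent_succ_eq_span (d n : ℕ) :
    freeLieComponent d (n + 1) = Submodule.span ℚ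
      ((fun w : FreeMonoid (Fin d) => leftBracket (FreeLieAlgebra.of ℚ) w.toList) ''
        {w | w.length = n + 1}) := by
  induction n with
  | zero =>
    rw [freeLieComponent]
    congr 1
    ext z
    constructor
    · rintro ⟨i, rfl⟩
      exact ⟨FreeMonoid.of i, FreeMonoid.length_of i, rfl⟩
    · rintro ⟨w, hw, rfl⟩
      obtain ⟨i, rfl⟩ := FreeMonoid.length_eq_one.1 hw
      exact ⟨i, rfl⟩
  | succ n ih =>
    rw [freeLieComponent]
    apply le_antisymm
    · rw [Submodule.span_le]
      rintro _ ⟨i, y, hy, rfl⟩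
      rw [ih] at hy
      induction hy using Submodule.span_induction with
      | mem y hy =>
        obtain ⟨w, hw, rfl⟩ := hy
        rw [SetLike.mem_coe, ← lie_skew]
        refine neg_mem (Submodule.subset_span ⟨w * FreeMonoid.of i, ?_, ?_⟩)
        · rw [Set.mem_ofPred_eq, FreeMonoid.length_mul, FreeMonoid.length_of, hw]
        · cases w using FreeMonoid.casesOn with
          | one => simp at hw
          | of_mul x u =>
            exact leftBracketFrom_append_singleton _ _ u.toList i
      | zero => rw [lie_zero]; exact zero_mem _
      | add y z _ _ hy hz => rw [lie_add]; exact add_mem hy hz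
      | smul c y _ hy => rw [lie_smul]; exact Submodule.smul_mem _ c hy
    · rw [Submodule.span_le]
      rintro _ ⟨w, hw, rfl⟩
      change w.toList.length = n + 2 at hw
      obtain ⟨x, u, hu⟩ := List.exists_cons_of_length_eq_add_one hw
      have hune : u ≠ [] := by
        rintro rfl
        simp [hu] at hw
      obtain ⟨v, i, rfl⟩ := List.eq_nil_or_concat' u |>.resolve_left hune
      have : leftBracket (FreeLieAlgebra.of ℚ) w.toList
          = -⁅FreeLieAlgebra.of ℚ i, leftBracket (FreeLieAlgebra.of ℚ) (x :: v)⁆ := by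
        rw [lie_skew, hu]
        exact leftBracketFrom_append_singleton _ _ v i
      simp only [SetLike.mem_coe]
      rw [this]
      refine neg_mem (Submodule.subset_span ⟨i, _, ?_, rfl⟩)
      rw [ih]
      refine Submodule.subset_span ⟨FreeMonoid.ofList (x :: v), ?_, rfl⟩
      rw [hu] at hw
      simpa [FreeMonoid.length] using hw

/-- The endomorphism `(l, c) ↦ (⁅x, l⁆ + c • x, 0)` of `L × R`. -/
def affineAd (R : Type*) {L : Type*} [CommRing R] [LieRing L] [LieAlgebra R L] (x : L) :
    Module.End R (L × R) :=
  LinearMap.inl R L R ∘ₗ ((LieModule.toEnd R L L x).coprod (LinearMap.toSpanSingleton R L x))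

theorem affineAd_apply {R L : Type*} [CommRing R] [LieRing L] [LieAlgebra R L] (x : L)
    (p : L × R) : affineAd R x p = (⁅x, p.1⁆ + p.2 • x, 0) := rfl

/-- The embedding of the free Lie algebra into the word algebra. -/
noncomputable def freeLieToWord (R : Type*) [Field R] (α : Type*) :
    FreeLieAlgebra R α →ₗ⁅R⁆ MonoidAlgebra R (FreeMonoid α) :=
  FreeLieAlgebra.lift R (letter R)

/-- The representation of the free Lie algebra in which generators act by `affineAd`. -/
noncomputable def affineRep (R : Type*) [Field R] (α : Type*) :
    FreeLieAlgebra R α →ₗ⁅R⁆ Module.End R (FreeLieAlgebra R α × R) :=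
  FreeLieAlgebra.lift R fun x => affineAd R (FreeLieAlgebra.of R x)

theorem affineRep_of (R : Type*) [Field R] (x : α) :
    affineRep R α (FreeLieAlgebra.of R x) = affineAd R (FreeLieAlgebra.of R x) :=
  FreeLieAlgebra.lift_of_apply ..

theorem affineRep_eq_zero {R : Type*} [Field R] {a : FreeLieAlgebra R α}
    (ha : freeLieToWord R α a = 0) : affineRep R α a = 0 := by
  let φ : MonoidAlgebra R (FreeMonoid α) →ₐ[R] Module.End R (FreeLieAlgebra R α × R) :=
    MonoidAlgebra.lift R _ (FreeMonoid α) (FreeMonoid.lift fun x =>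
      affineAd R (FreeLieAlgebra.of R x))
  have h : (φ : MonoidAlgebra R (FreeMonoid α) →ₗ⁅R⁆ _).comp (freeLieToWord R α)
      = affineRep R α := by
    refine FreeLieAlgebra.hom_ext fun x => ?_
    rw [affineRep_of, LieHom.comp_apply, freeLieToWord, FreeLieAlgebra.lift_of_apply]
    simp [φ, letter]
  rw [← h, LieHom.comp_apply, ha, map_zero]

theorem affineRep_apply_of_mem {d n : ℕ} {a : FreeLieAlgebra ℚ (Fin d)}
    (ha : a ∈ freeLieComponent d (n + 1)) (p : FreeLieAlgebra ℚ (Fin d) × ℚ) :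
    affineRep ℚ (Fin d) a p = (⁅a, p.1⁆ + (p.2 * (n + 1)) • a, 0) := by
  induction n generalizing a p with
  | zero =>
    rw [freeLieComponent] at ha
    induction ha using Submodule.span_induction with
    | mem a ha =>
      obtain ⟨i, rfl⟩ := ha
      rw [affineRep_of, affineAd_apply]
      simp
    | zero => rw [map_zero, LinearMap.zero_apply, zero_lie, smul_zero, add_zero]; rfl
    | add a b _ _ ha hb =>
      rw [map_add, LinearMap.add_apply, ha, hb, Prod.mk_add_mk, add_lie, smul_add, add_zero]
      congr 1
      abel
    | smul c a _ ha =>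
      rw [map_smul, LinearMap.smul_apply, ha, Prod.smul_mk, smul_lie, smul_add, smul_zero,
        smul_comm c]
  | succ n ih =>
    rw [freeLieComponent] at ha
    induction ha using Submodule.span_induction with
    | mem a ha =>
      obtain ⟨i, y, hy, rfl⟩ := ha
      rw [LieHom.map_lie, LieRing.of_associative_ring_bracket, affineRep_of,
        LinearMap.sub_apply, Module.End.mul_apply, Module.End.mul_apply, affineAd_apply,
        affineAd_apply, ih hy, ih hy, Prod.mk_sub_mk]
      simp only [zero_smul, zero_mul, add_zero, sub_zero, lie_add, lie_smul, lie_lie]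
      congr 1
      rw [← lie_skew y (FreeLieAlgebra.of ℚ i)]
      push_cast
      module
    | zero => rw [map_zero, LinearMap.zero_apply, zero_lie, smul_zero, add_zero]; rfl
    | add a b _ _ ha hb =>
      rw [map_add, LinearMap.add_apply, ha, hb, Prod.mk_add_mk, add_lie, smul_add, add_zero]
      congr 1
      abel
    | smul c a _ ha =>
      rw [map_smul, LinearMap.smul_apply, ha, Prod.smul_mk, smul_lie, smul_add, smul_zero,
        smul_comm c]

theorem eq_zero_of_freeLieToWord_eq_zero {d n : ℕ} {a : FreeLieAlgebra ℚ (Fin d)}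
    (ha : a ∈ freeLieComponent d (n + 1)) (h : freeLieToWord ℚ (Fin d) a = 0) : a = 0 := by
  have h1 := affineRep_apply_of_mem ha (0, 1)
  rw [affineRep_eq_zero h] at h1
  have h2 := congrArg Prod.fst h1
  simp only [LinearMap.zero_apply, Prod.fst_zero, lie_zero, one_mul, zero_add] at h2
  exact (smul_eq_zero.1 h2.symm).resolve_left (by positivity)

theorem map_freeLieToWord_freeLieComponent (d n : ℕ) :
    (freeLieComponent d (n + 1)).map (freeLieToWord ℚ (Fin d)).toLinearMap
      = bracketSpan ℚ (Fin d) (n + 1) := by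
  rw [freeLieComponent_succ_eq_span, Submodule.map_span, Set.image_image, bracketSpan]
  congr 1
  refine Set.image_congr fun w _ => ?_
  have h := map_leftBracket (FreeLieAlgebra.of ℚ) (freeLieToWord ℚ (Fin d)) (map_zero _)
    (LieHom.map_lie _) w.toList
  rw [freeLieToWord, FreeLieAlgebra.of_comp_lift] at h
  exact h

theorem finrank_freeLieComponent (d n : ℕ) :
    finrank ℚ (freeLieComponent d (n + 1)) = finrank ℚ (bracketSpan ℚ (Fin d) (n + 1)) := by
  rw [← map_freeLieToWord_freeLieComponent, ← LinearMap.range_domRestrict]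
  refine (LinearMap.finrank_range_of_inj ((injective_iff_map_eq_zero _).2 fun t ht => ?_)).symm
  exact Subtype.ext (eq_zero_of_freeLieToWord_eq_zero t.2 ht)

theorem finiteDimensional_freeLieComponent_succ (d n : ℕ) :
    FiniteDimensional ℚ (freeLieComponent d (n + 1)) := by
  rw [freeLieComponent_succ_eq_span]
  exact FiniteDimensional.span_of_finite ℚ (Set.Finite.image _ (List.finite_length_eq _ _))

end FreeLie

end Helpers

/-- **Witt dimension formula.**  For `d ≥ 1` and `n ≥ 1`, the degree-`n`
homogeneous component of the free Lie algebra over `ℚ` on `d` generators is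
finite dimensional, of dimension `(1/n) ∑_{k ∣ n} μ(k) d^{n/k}`, where `μ` is
the Möbius function. -/
theorem witt_dimension_formula (d n : ℕ) (hd : 1 ≤ d) (hn : 1 ≤ n) :
    FiniteDimensional ℚ (freeLieComponent d n) ∧
    (Module.finrank ℚ (freeLieComponent d n) : ℚ)
      = (1 / (n : ℚ)) * ∑ k ∈ n.divisors,
          ((ArithmeticFunction.moebius k : ℤ) : ℚ) * (d : ℚ) ^ (n / k) := by
  refine ⟨?_, ?_⟩
  · obtain ⟨n, rfl⟩ := Nat.exists_eq_add_of_le' hn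
    exact finiteDimensional_freeLieComponent_succ d n
  · have h := WordAlgebra.finrank_bracketSpan_rat (α := Fin d) hn
    rw [Fintype.card_fin] at h
    rw [← h]
    obtain ⟨n, rfl⟩ := Nat.exists_eq_add_of_le' hn
    rw [finrank_freeLieComponent]
    field_simp
end

section
/- Let X : ℝ → ℝᵈ be continuously differentiable, let L : ℝᵃ → (ℝᵈ → ℝᵃ) and L̃ : ℝᵇ → (ℝᵈ → ℝᵇ) be linear maps into the spaces of linear maps (linear vector fields), and let Y : ℝ → ℝᵃ and Ỹ : ℝ → ℝᵇ be differentiable functions satisfying the linear controlled differential equations Y′(t) = L(Y(t))(X′(t)) and Ỹ′(t) = L̃(Ỹ(t))(X′(t)) for all t. Then the matrix-valued function Z : ℝ → ℝ^{a×b} with entries Z_{ij}(t) = Y_i(t)·Ỹ_j(t) satisfies the linear controlled differential equation Z′(t) = M(Z(t))(X′(t)) for all t, where M : ℝ^{a×b} → (ℝᵈ → ℝ^{a×b}) is the linear map defined entrywise by M(Z)(v)_{ij} = Σ_{k=1}^{a} L(e_k)(v)_i · Z_{kj} + Σ_{k=1}^{b} Z_{ik} · L̃(f_k)(v)_j, with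 (e_k) and (f_k) the standard bases of ℝᵃ and ℝᵇ. In particular, every product of a linear functional of Y with a linear functional of Ỹ is a linear functional of the solution Z of a linear controlled differential equation driven by the same path X. -/
/-- A linear map into the linear maps `V → (ι → ℝ)` is determined by its values on the standard
basis. -/
theorem linearVectorField_apply_eq_sum {n ι V : Type*} [Fintype n] [DecidableEq n]
    [AddCommGroup V] [Module ℝ V] (L : (n → ℝ) →ₗ[ℝ] V →ₗ[ℝ] (ι → ℝ))
    (y : n → ℝ) (v : V) (i : ι) :
    L y v i = ∑ k, L (Pi.single k 1) v i * y k := by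
  conv_lhs => rw [pi_eq_sum_univ' y]
  simp [mul_comm]

/-- **Products of solutions of linear controlled differential equations.**
Let `X : ℝ → ℝᵈ` be continuously differentiable with derivative `X'`, let
`L`, `L̃` be linear vector fields on `ℝᵃ`, `ℝᵇ` driven by `ℝᵈ`, and let
`Y`, `Ỹ` solve `Y′(t) = L(Y(t))(X′(t))` and `Ỹ′(t) = L̃(Ỹ(t))(X′(t))`.
Then the matrix-valued function `Z` with entries `Z_{ij}(t) = Y_i(t) Ỹ_j(t)`
solves the linear controlled differential equation `Z′(t) = M(Z(t))(X′(t))`,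
where `M(Z)(v)_{ij} = ∑_k L(e_k)(v)_i Z_{kj} + ∑_k Z_{ik} L̃(f_k)(v)_j` with
`(e_k)`, `(f_k)` the standard bases. -/
theorem tensor_product_linear_CDE (d a b : ℕ)
    (X X' : ℝ → Fin d → ℝ)
    (hX : ∀ t : ℝ, HasDerivAt X (X' t) t)
    (hX'c : Continuous X')
    (L : (Fin a → ℝ) →ₗ[ℝ] (Fin d → ℝ) →ₗ[ℝ] (Fin a → ℝ))
    (Lt : (Fin b → ℝ) →ₗ[ℝ] (Fin d → ℝ) →ₗ[ℝ] (Fin b → ℝ))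
    (Y : ℝ → Fin a → ℝ) (Yt : ℝ → Fin b → ℝ)
    (hY : ∀ t : ℝ, HasDerivAt Y (L (Y t) (X' t)) t)
    (hYt : ∀ t : ℝ, HasDerivAt Yt (Lt (Yt t) (X' t)) t) :
    ∀ t : ℝ,
      HasDerivAt
        (fun s : ℝ => (fun i j => Y s i * Yt s j : Fin a → Fin b → ℝ))
        (fun i j =>
          (∑ k : Fin a, L (Pi.single k 1) (X' t) i * (Y t k * Yt t j)) +
          (∑ k : Fin b, (Y t i * Yt t k) * Lt (Pi.single k 1) (X' t) j)) t := by
  intro t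
  refine hasDerivAt_pi.2 fun i => hasDerivAt_pi.2 fun j => ?_
  refine ((hasDerivAt_pi.1 (hY t) i).mul (hasDerivAt_pi.1 (hYt t) j)).congr_deriv ?_
  rw [linearVectorField_apply_eq_sum L, linearVectorField_apply_eq_sum Lt, Finset.sum_mul,
    Finset.mul_sum]
  congr 1 <;> exact Finset.sum_congr rfl fun k _ => by ring
end
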